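/- Let h, c₀ ∈ ℂ with c₀ ≠ 0. Let 𝔅 = ℂL_0 ⊕ ℂI_0 ⊕ 𝔖_+ be the subalgebra of 𝔖 spanned by L_0, I_0 and {L_m, I_m, G_m : m ≥ 1}, and let ℂv_h be the one-dimensional (purely even) 𝔅-module with L_0 v_h = h v_h, I_0 v_h = c₀ v_h, and L_m v_h = I_m v_h = G_m v_h = 0 for all m ≥ 1. Then the Verma module 𝔙(h, c₀) = U(𝔖) ⊗_{U(𝔅)} ℂv_h is a simple 𝔖-module. -/

import Mathlib

/-- Basis of the super Heisenberg-Virasoro algebra of Ramond type 𝔖: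
`l m = L_m`, `i m = I_m`, `g m = G_m`. -/
inductive SB : Type
  | l : ℤ → SB
  | i : ℤ → SB
  | g : ℤ → SB
  deriving DecidableEq

/-- The underlying space of 𝔖: formal finite ℂ-linear combinations of basis elements. -/
abbrev SHV : Type := SB →₀ ℂ

/-- Parity: `L_m, I_m` are even, `G_m` is odd. -/
def par : SB → ZMod 2
  | .g _ => 1
  | _ => 0

/-- The bracket of 𝔖 on basis elements:
`[L_m, L_n] = (n-m)L_{m+n}`, `[L_m, I_n] = n I_{m+n}`, `[L_m, G_n] = n G_{m+n}`,
`[G_m, G_n] = 2 I_{m+n}`, all other brackets of basis elements vanish. -/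
noncomputable def sb : SB → SB → SHV
  | .l m, .l n => ((n : ℂ) - (m : ℂ)) • Finsupp.single (.l (m + n)) 1
  | .l m, .i n => (n : ℂ) • Finsupp.single (.i (m + n)) 1
  | .i m, .l n => (-(m : ℂ)) • Finsupp.single (.i (m + n)) 1
  | .l m, .g n => (n : ℂ) • Finsupp.single (.g (m + n)) 1
  | .g m, .l n => (-(m : ℂ)) • Finsupp.single (.g (m + n)) 1
  | .g m, .g n => (2 : ℂ) • Finsupp.single (.i (m + n)) 1
  | _, _ => 0

/-- The bracket of 𝔖, extended bilinearly to the whole space. -/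
noncomputable def br (x y : SHV) : SHV :=
  x.sum fun a ca => y.sum fun b cb => (ca * cb) • sb a b

/-- The sign `(-1)^{|a||b|}`. -/
noncomputable def sgn (a b : SB) : ℂ := if par a = 1 ∧ par b = 1 then -1 else 1

/-- A ℤ₂-graded representation of the subalgebra of 𝔖 spanned by the set `Q` of basis
elements (for `Q = Set.univ` this is a module over 𝔖 itself): a ℤ₂-graded complex vector
space with a parity-respecting action of the basis elements of `Q` satisfying the
super-commutation relations dictated by the bracket `sb`. -/
structure GRep (Q : Set SB) : Type 1 where
  V : Type
  [acg : AddCommGroup V]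
  [mod : Module ℂ V]
  act : SB → V →ₗ[ℂ] V
  grade : ZMod 2 → Submodule ℂ V
  grade_sup : ∀ v : V, ∃ v0 ∈ grade 0, ∃ v1 ∈ grade 1, v = v0 + v1
  grade_inf : grade 0 ⊓ grade 1 = ⊥
  act_grade : ∀ a ∈ Q, ∀ p : ZMod 2, ∀ v ∈ grade p, act a v ∈ grade (par a + p)
  act_br : ∀ a ∈ Q, ∀ b ∈ Q, ∀ v : V,
    act a (act b v) - sgn a b • act b (act a v) = (sb a b).sum fun c cc => cc • act c v

attribute [instance] GRep.acg GRep.mod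

/-- A (graded) submodule of a graded representation: a subspace stable under the action
and generated by its homogeneous components. -/
def IsSub {Q : Set SB} (ρ : GRep Q) (U : Submodule ℂ ρ.V) : Prop :=
  (∀ a ∈ Q, ∀ v ∈ U, ρ.act a v ∈ U) ∧
  ∀ v ∈ U, ∃ v0, v0 ∈ U ∧ v0 ∈ ρ.grade 0 ∧ ∃ v1, v1 ∈ U ∧ v1 ∈ ρ.grade 1 ∧ v = v0 + v1

/-- Simplicity: nonzero, and the only graded submodules are `⊥` and `⊤`. -/
def IsSimple {Q : Set SB} (ρ : GRep Q) : Prop :=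
  (∃ v : ρ.V, v ≠ 0) ∧ ∀ U : Submodule ℂ ρ.V, IsSub ρ U → U = ⊥ ∨ U = ⊤

/-- A linear map between graded representations which is even and `Q`-equivariant. -/
def SEquivMap (Q : Set SB) {Q1 Q2 : Set SB} (ρ : GRep Q1) (σ : GRep Q2)
    (f : ρ.V →ₗ[ℂ] σ.V) : Prop :=
  (∀ a ∈ Q, ∀ v : ρ.V, f (ρ.act a v) = σ.act a (f v)) ∧
  ∀ p : ZMod 2, ∀ v ∈ ρ.grade p, f v ∈ σ.grade p

/-- `(M, ι)` is the representation induced from the `Q`-representation `ρ` to the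
subalgebra spanned by `Q'` (i.e. `M = U(𝔤_{Q'}) ⊗_{U(𝔤_Q)} ρ`), characterized by its
universal property. -/
def IsInduced (Q : Set SB) {Q' : Set SB} (ρ : GRep Q) (M : GRep Q')
    (ι : ρ.V →ₗ[ℂ] M.V) : Prop :=
  SEquivMap Q ρ M ι ∧
  ∀ (N : GRep Q') (f : ρ.V →ₗ[ℂ] N.V), SEquivMap Q ρ N f →
    ∃! F : M.V →ₗ[ℂ] N.V, SEquivMap Q' M N F ∧ F ∘ₗ ι = f

/-- Basis of the subalgebra 𝔖_{α,β} = span{L_i, I_{i-α}, G_{i-β} : i ≥ 0}. -/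
def QS (α β : ℕ) : Set SB := fun x =>
  match x with
  | .l m => 0 ≤ m
  | .i m => -(α : ℤ) ≤ m
  | .g m => -(β : ℤ) ≤ m

/-- Basis of the subalgebra 𝔖^{(r,s,t)} = span{L_i : i ≥ r} ∪ {I_i : i ≥ s} ∪ {G_i : i ≥ t}. -/
def Qrst (r s t : ℕ) : Set SB := fun x =>
  match x with
  | .l m => (r : ℤ) ≤ m
  | .i m => (s : ℤ) ≤ m
  | .g m => (t : ℤ) ≤ m

/-- Basis of T(r) = 𝔖^{(r,r,r)}. -/
def T (r : ℕ) : Set SB := Qrst r r r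

/-- A restricted 𝔖-module. -/
def IsRestricted (ρ : GRep (Set.univ : Set SB)) : Prop :=
  ∀ w : ρ.V, ∃ k : ℕ, ∀ i : ℤ, (k : ℤ) < i →
    ρ.act (.l i) w = 0 ∧ ρ.act (.g i) w = 0 ∧ ρ.act (.i i) w = 0

/-- Local nilpotency of the action of a single operator. -/
def LocNil {W : Type} [AddCommGroup W] [Module ℂ W] (f : W →ₗ[ℂ] W) : Prop :=
  ∀ v : W, ∃ n : ℕ, (f ^ n) v = 0

/-- Local finiteness of the action of a single operator. -/
def LocFin {W : Type} [AddCommGroup W] [Module ℂ W] (f : W →ₗ[ℂ] W) : Prop :=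
  ∀ v : W, FiniteDimensional ℂ (Submodule.span ℂ (Set.range fun n : ℕ => (f ^ n) v))

/-- Basis of the subalgebra 𝔅 = ℂL₀ ⊕ ℂI₀ ⊕ 𝔖₊ of 𝔖. -/
def QVerma : Set SB := fun x =>
  match x with
  | .l m => 0 ≤ m
  | .i m => 0 ≤ m
  | .g m => 1 ≤ m

namespace SuperHV

/-- Operators `L m`, `I m`, `G m` satisfying the defining relations of the
super Heisenberg-Virasoro algebra. -/
structure Relations {E : Type*} [AddCommGroup E] [Module ℂ E] (L I G : ℤ → E →ₗ[ℂ] E) :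
    Prop where
  ll : ∀ m n u, L m (L n u) = L n (L m u) + ((n : ℂ) - m) • L (m + n) u
  li : ∀ m n u, L m (I n u) = I n (L m u) + (n : ℂ) • I (m + n) u
  lg : ∀ m n u, L m (G n u) = G n (L m u) + (n : ℂ) • G (m + n) u
  ii : ∀ m n u, I m (I n u) = I n (I m u)
  ig : ∀ m n u, I m (G n u) = G n (I m u)
  gg : ∀ m n u, G m (G n u) = -G n (G m u) + (2 : ℂ) • I (m + n) u

/-- `x` is a highest weight vector of weight `(h, c)`. -/
structure HighestWeight {E : Type*} [AddCommGroup E] [Module ℂ E] (L I G : ℤ → E →ₗ[ℂ] E)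
    (h c : ℂ) (x : E) : Prop where
  l_zero : L 0 x = h • x
  i_zero : I 0 x = c • x
  l_pos : ∀ m, 0 < m → L m x = 0
  i_pos : ∀ m, 0 < m → I m x = 0
  g_pos : ∀ m, 0 < m → G m x = 0

section Generation

variable {E : Type*} [AddCommGroup E] [Module ℂ E]

/-- The smallest subspace containing `B` and stable under the operators `A i`. -/
def generated {κ : Type*} (A : κ → E →ₗ[ℂ] E) (B : Set E) : Submodule ℂ E :=
  sInf {S | B ⊆ S ∧ ∀ i, ∀ u ∈ S, A i u ∈ S}

theorem subset_generated {κ : Type*} (A : κ → E →ₗ[ℂ] E) (B : Set E) :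
    B ⊆ generated A B := fun _ hx =>
  (Submodule.mem_sInf).2 fun _ hS => hS.1 hx

theorem generated_stable {κ : Type*} (A : κ → E →ₗ[ℂ] E) (B : Set E) (i : κ) {u : E}
    (hu : u ∈ generated A B) : A i u ∈ generated A B :=
  (Submodule.mem_sInf).2 fun S hS => hS.2 i u ((Submodule.mem_sInf).1 hu S hS)

theorem generated_le {κ : Type*} {A : κ → E →ₗ[ℂ] E} {B : Set E} {S : Submodule ℂ E}
    (hB : B ⊆ S) (hA : ∀ i, ∀ u ∈ S, A i u ∈ S) : generated A B ≤ S :=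
  sInf_le ⟨hB, hA⟩

/-- Filtration by the number of applied raising operators `X k`, starting from `S` in
degree `1`. -/
def ladder (X : ℕ → E →ₗ[ℂ] E) (S : Submodule ℂ E) : ℕ → Submodule ℂ E
  | 0 => ⊥
  | 1 => S
  | d + 2 => ladder X S (d + 1) ⊔ ⨆ k, (ladder X S (d + 1)).map (X k)

variable {X : ℕ → E →ₗ[ℂ] E} {S : Submodule ℂ E}

theorem ladder_mono : Monotone (ladder X S) := by
  refine monotone_nat_of_le_succ fun d => ?_
  rcases d with _ | d
  · exact bot_le
  · exact le_sup_left

theorem ladder_raise {d : ℕ} (k : ℕ) {u : E} (hu : u ∈ ladder X S d) :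
    X k u ∈ ladder X S (d + 1) := by
  rcases d with _ | d
  · have : u = 0 := hu
    simp [this]
  · exact Submodule.mem_sup_right
      (Submodule.mem_iSup_of_mem k (Submodule.mem_map_of_mem hu))

theorem ladder_succ_le {d : ℕ} {R : Submodule ℂ E} (h : ladder X S (d + 1) ≤ R)
    (hX : ∀ k, ∀ u ∈ ladder X S (d + 1), X k u ∈ R) : ladder X S (d + 2) ≤ R :=
  sup_le h (iSup_le fun k => Submodule.map_le_iff_le_comap.2 (hX k))

/-- An operator shifting the ladder degree by `e` on the base, and commuting with the raising
operators up to lower terms, shifts the degree by `e` everywhere. -/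
theorem ladder_shift (A : E →ₗ[ℂ] E) (e : ℕ) (hS : ∀ u ∈ S, A u ∈ ladder X S (e + 1))
    (hX : ∀ d k, ∀ u ∈ ladder X S (d + 1), A u ∈ ladder X S (d + 1 + e) →
      A (X k u) ∈ ladder X S (d + 2 + e)) (d : ℕ) {u : E} (hu : u ∈ ladder X S d) :
    A u ∈ ladder X S (d + e) := by
  suffices H : ∀ d, ladder X S d ≤ (ladder X S (d + e)).comap A from H d hu
  intro d
  induction d with
  | zero => exact bot_le
  | succ d ih =>
    rcases d with _ | d
    · intro u hu
      have := hS u hu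
      rwa [add_comm e 1] at this
    · refine ladder_succ_le (fun u hu => ladder_mono (by omega) (ih hu)) fun k u hu => ?_
      exact hX d k u hu (ih hu)

theorem ladder_lower (A : E →ₗ[ℂ] E) (hS : ∀ u ∈ S, A u = 0)
    (hX : ∀ d k, ∀ u ∈ ladder X S (d + 1), A u ∈ ladder X S d →
      A (X k u) ∈ ladder X S (d + 1)) (d : ℕ) {u : E} (hu : u ∈ ladder X S (d + 1)) :
    A u ∈ ladder X S d := by
  suffices H : ∀ d, ladder X S (d + 1) ≤ (ladder X S d).comap A from H d hu
  intro d
  induction d with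
  | zero => exact fun u hu => by simp [hS u hu]
  | succ d ih =>
    refine ladder_succ_le (fun u hu => ladder_mono (by omega) (ih hu)) fun k u hu => ?_
    exact hX d k u hu (ih hu)

theorem ladder_eq_zero (A : E →ₗ[ℂ] E) (hS : ∀ u ∈ S, A u = 0)
    (hX : ∀ k u, A u = 0 → A (X k u) = 0) (d : ℕ) {u : E} (hu : u ∈ ladder X S d) :
    A u = 0 := by
  suffices H : ∀ d, ladder X S d ≤ LinearMap.ker A from H d hu
  intro d
  induction d with
  | zero => exact bot_le
  | succ d ih =>
    rcases d with _ | d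
    · exact hS
    · exact ladder_succ_le ih fun k u hu => hX k u (ih hu)

theorem mem_ladder_iSup {u : E} : u ∈ (⨆ d, ladder X S d) ↔ ∃ d, u ∈ ladder X S d :=
  Submodule.mem_iSup_of_directed _ ladder_mono.directed_le

/-- A subspace with enough closure properties contains everything generated, hence every
generated vector lies in some step of the ladder. -/
theorem exists_mem_ladder {κ : Type*} {A : κ → E →ₗ[ℂ] E} {B : Set E} (hB : B ⊆ S)
    (hA : ∀ i d, ∀ u ∈ ladder X S d, ∃ d', A i u ∈ ladder X S d') {u : E}
    (hu : u ∈ generated A B) : ∃ d, u ∈ ladder X S (d + 1) := by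
  have hle : generated A B ≤ ⨆ d, ladder X S d := by
    refine generated_le (fun b hb => mem_ladder_iSup.2 ⟨1, hB hb⟩) fun i u hu => ?_
    obtain ⟨d, hd⟩ := mem_ladder_iSup.1 hu
    exact mem_ladder_iSup.2 (hA i d u hd)
  obtain ⟨d, hd⟩ := mem_ladder_iSup.1 (hle hu)
  exact ⟨d, ladder_mono d.le_succ hd⟩

end Generation

section Inverse

variable {E : Type*} [AddCommGroup E] [Module ℂ E]

/-- Coefficients of the inverse of the power series `∑ I (-n) zⁿ` with constant term `c`. -/
noncomputable def invCoeff (I : ℤ → E →ₗ[ℂ] E) (c : ℂ) : ℕ → E →ₗ[ℂ] E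
  | n => c⁻¹ • ((if n = 0 then LinearMap.id else 0) -
      ∑ i : Fin n, invCoeff I c i ∘ₗ I (i - n))
  decreasing_by exact i.2

theorem sum_invCoeff {I : ℤ → E →ₗ[ℂ] E} {c : ℂ} (hc : c ≠ 0) (hI : ∀ u, I 0 u = c • u)
    (n : ℕ) (u : E) :
    ∑ i ∈ Finset.range (n + 1), invCoeff I c i (I (i - n) u) = if n = 0 then u else 0 := by
  rw [Finset.sum_range_succ, sub_self, hI, map_smul]
  conv_lhs => rw [invCoeff]
  rw [← Fin.sum_univ_eq_sum_range (fun i => invCoeff I c i (I (i - n) u))]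
  simp only [LinearMap.smul_apply, smul_smul, mul_inv_cancel₀ hc, one_smul, LinearMap.sub_apply,
    LinearMap.sum_apply, LinearMap.comp_apply]
  split_ifs <;> simp

theorem invCoeff_mem {I : ℤ → E →ₗ[ℂ] E} {c : ℂ} {R : Submodule ℂ E}
    (hR : ∀ n, ∀ u ∈ R, I n u ∈ R) (n : ℕ) {u : E} (hu : u ∈ R) : invCoeff I c n u ∈ R := by
  induction n using Nat.strong_induction_on generalizing u with
  | _ n ih =>
    rw [invCoeff]
    simp only [LinearMap.smul_apply, LinearMap.sub_apply, LinearMap.sum_apply,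
      LinearMap.comp_apply]
    refine R.smul_mem _ (R.sub_mem ?_ (R.sum_mem fun i _ => ih i i.2 (hR _ _ hu)))
    split_ifs
    · exact hu
    · exact R.zero_mem

/-- If commutators with `A` of the operators `I n` preserve `R`, so do those of the inverse
coefficients. -/
theorem invCoeff_comm_mem {I : ℤ → E →ₗ[ℂ] E} {c : ℂ} {R : Submodule ℂ E} (A : E →ₗ[ℂ] E)
    (hR : ∀ n, ∀ u ∈ R, I n u ∈ R) (hA : ∀ n, ∀ u ∈ R, I n (A u) - A (I n u) ∈ R)
    (n : ℕ) {u : E} (hu : u ∈ R) : invCoeff I c n (A u) - A (invCoeff I c n u) ∈ R := by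
  induction n using Nat.strong_induction_on generalizing u with
  | _ n ih =>
    rw [invCoeff]
    simp only [LinearMap.smul_apply, LinearMap.sub_apply, LinearMap.sum_apply,
      LinearMap.comp_apply, map_smul, map_sub, map_sum, ← smul_sub]
    refine R.smul_mem _ ?_
    rw [sub_sub_sub_comm, ← Finset.sum_sub_distrib]
    refine R.sub_mem ?_ (R.sum_mem fun i _ => ?_)
    · split_ifs <;> simp
    · have h1 := ih i i.2 (hR (i - n) u hu)
      have h2 := invCoeff_mem (c := c) hR i (hA (i - n) u hu)
      have := R.add_mem h1 h2
      rw [map_sub] at this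
      convert this using 1
      abel

theorem invCoeff_comm {I : ℤ → E →ₗ[ℂ] E} {c : ℂ} (A : E →ₗ[ℂ] E)
    (hA : ∀ n u, I n (A u) = A (I n u)) (n : ℕ) (u : E) :
    invCoeff I c n (A u) = A (invCoeff I c n u) := by
  induction n using Nat.strong_induction_on generalizing u with
  | _ n ih =>
    rw [invCoeff]
    simp only [LinearMap.smul_apply, LinearMap.sub_apply, LinearMap.sum_apply,
      LinearMap.comp_apply, map_smul, map_sub, map_sum]
    congr 2
    · split_ifs <;> simp
    · exact Finset.sum_congr rfl fun i _ => by rw [hA, ih i i.2]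

end Inverse

section Descent

variable {E : Type*} [AddCommGroup E] [Module ℂ E]

/-- The operator counting the raising operators `X k` up to lower terms. -/
noncomputable def counter (X Y J : ℕ → E →ₗ[ℂ] E) (K : ℕ) : E →ₗ[ℂ] E :=
  ∑ m ∈ Finset.range K, ∑ k ∈ Finset.range (m + 1), X k ∘ₗ J (m - k) ∘ₗ Y m

variable {X Y J : ℕ → E →ₗ[ℂ] E} {I : ℤ → E →ₗ[ℂ] E} {S : Submodule ℂ E} {ε : ℂ}

theorem counter_apply (K : ℕ) (u : E) : counter X Y J K u =
    ∑ m ∈ Finset.range K, ∑ k ∈ Finset.range (m + 1), X k (J (m - k) (Y m u)) := by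
  simp [counter, LinearMap.sum_apply]

theorem sum_raise_inv (hJ : ∀ n u, ∑ i ∈ Finset.range (n + 1), J i (I (i - n) u) =
    if n = 0 then u else 0) (j : ℕ) (u : E) :
    ∑ m ∈ Finset.range (j + 1), ∑ k ∈ Finset.range (m + 1), X k (J (m - k) (I (m - j) u)) =
      X j u := by
  have hswap : ∑ m ∈ Finset.range (j + 1), ∑ k ∈ Finset.range (m + 1),
      X k (J (m - k) (I (m - j) u)) =
      ∑ k ∈ Finset.range (j + 1), ∑ i ∈ Finset.range (j - k + 1),
        X k (J i (I (i - ((j - k : ℕ) : ℤ)) u)) := by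
    rw [Finset.sum_sigma', Finset.sum_sigma']
    refine Finset.sum_bij' (fun p _ => ⟨p.2, p.1 - p.2⟩) (fun p _ => ⟨p.1 + p.2, p.1⟩)
      ?_ ?_ ?_ ?_ ?_
    · rintro ⟨m, k⟩ h
      simp only [Finset.mem_sigma, Finset.mem_range] at h ⊢
      omega
    · rintro ⟨m, k⟩ h
      simp only [Finset.mem_sigma, Finset.mem_range] at h ⊢
      omega
    · rintro ⟨m, k⟩ h
      simp only [Finset.mem_sigma, Finset.mem_range] at h
      have : k + (m - k) = m := by omega
      simp [this]
    · rintro ⟨m, k⟩ h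
      simp
    · rintro ⟨m, k⟩ h
      simp only [Finset.mem_sigma, Finset.mem_range] at h
      have : ((m - k : ℕ) : ℤ) - ((j - k : ℕ) : ℤ) = m - j := by omega
      simp [this]
  rw [hswap]
  simp only [← map_sum, hJ]
  rw [Finset.sum_eq_single j]
  · simp
  · intro k hk hkj
    have : j - k ≠ 0 := by
      have := Finset.mem_range.1 hk
      omega
    simp [this]
  · simp

theorem counter_sub_mem (hε : ε * ε = 1) (hS : ∀ m, ∀ u ∈ S, Y m u = 0)
    (hYX : ∀ m j u, Y m (X j u) = ε • X j (Y m u) + I (m - j) u)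
    (hJ : ∀ n u, ∑ i ∈ Finset.range (n + 1), J i (I (i - n) u) = if n = 0 then u else 0)
    (hpos : ∀ d k i n, ∀ u ∈ ladder X S (d + 1), 0 < n →
      X k (J i (I n u)) ∈ ladder X S (d + 1))
    (hcomm : ∀ d k i j m, ∀ u ∈ ladder X S (d + 1),
      X k (J i (X j (Y m u))) - ε • X j (X k (J i (Y m u))) ∈ ladder X S (d + 1))
    (d : ℕ) {u : E} (hu : u ∈ ladder X S (d + 1)) :
    ∃ K₀, ∀ K, K₀ ≤ K → counter X Y J K u - (d : ℂ) • u ∈ ladder X S d := by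
  induction d generalizing u with
  | zero =>
    refine ⟨0, fun K _ => ?_⟩
    simp [counter_apply, hS _ u hu]
  | succ d ih =>
    let R : Submodule ℂ E :=
      { carrier := {u | ∃ K₀, ∀ K, K₀ ≤ K →
          counter X Y J K u - ((d + 1 : ℕ) : ℂ) • u ∈ ladder X S (d + 1)}
        zero_mem' := ⟨0, fun K _ => by simp⟩
        add_mem' := by
          rintro a b ⟨K₁, h₁⟩ ⟨K₂, h₂⟩
          refine ⟨max K₁ K₂, fun K hK => ?_⟩
          have := Submodule.add_mem _ (h₁ K (le_trans (le_max_left _ _) hK))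
            (h₂ K (le_trans (le_max_right _ _) hK))
          rw [map_add, smul_add]
          convert this using 1
          abel
        smul_mem' := by
          rintro c a ⟨K₁, h₁⟩
          refine ⟨K₁, fun K hK => ?_⟩
          have := Submodule.smul_mem _ c (h₁ K hK)
          rw [map_smul, smul_comm _ c a]
          rwa [smul_sub] at this }
    refine ladder_succ_le (R := R) (fun t ht => ?_) (fun j t ht => ?_) hu
    · obtain ⟨K₀, h⟩ := ih ht
      refine ⟨K₀, fun K hK => ?_⟩
      have := Submodule.sub_mem _ (ladder_mono d.le_succ (h K hK)) ht
      convert this using 1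
      push_cast
      module
    · obtain ⟨K₀, h⟩ := ih ht
      refine ⟨max K₀ (j + 1), fun K hK => ?_⟩
      have h1 : X j (counter X Y J K t - (d : ℂ) • t) ∈ ladder X S (d + 1) :=
        ladder_raise j (h K (le_trans (le_max_left _ _) hK))
      have hsplit : counter X Y J K (X j t) =
          ε • (∑ m ∈ Finset.range K, ∑ k ∈ Finset.range (m + 1),
            (X k (J (m - k) (X j (Y m t))) - ε • X j (X k (J (m - k) (Y m t))))) +
          X j (counter X Y J K t) +
          ∑ m ∈ Finset.range K, ∑ k ∈ Finset.range (m + 1),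
            X k (J (m - k) (I (m - j) t)) := by
        simp only [counter_apply, hYX, map_add, map_smul, map_sum, Finset.sum_add_distrib,
          Finset.sum_sub_distrib, smul_sub, ← Finset.smul_sum, smul_smul, hε, one_smul,
          sub_add_cancel]
      have hA : (∑ m ∈ Finset.range K, ∑ k ∈ Finset.range (m + 1),
            (X k (J (m - k) (X j (Y m t))) - ε • X j (X k (J (m - k) (Y m t))))) ∈
          ladder X S (d + 1) :=
        Submodule.sum_mem _ fun m _ => Submodule.sum_mem _ fun k _ => hcomm d k _ j m t ht
      have hB : (∑ m ∈ Finset.range K, ∑ k ∈ Finset.range (m + 1),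
            X k (J (m - k) (I (m - j) t))) - X j t ∈ ladder X S (d + 1) := by
        rw [← sum_raise_inv hJ j t (X := X),
          ← Finset.sum_range_add_sum_Ico _ (le_trans (le_max_right _ _) hK), add_sub_cancel_left]
        refine Submodule.sum_mem _ fun m hm => Submodule.sum_mem _ fun k _ =>
          hpos d k _ _ t ht ?_
        have := (Finset.mem_Ico.1 hm).1
        omega
      have := Submodule.add_mem _ (Submodule.add_mem _ (Submodule.smul_mem _ ε hA) h1) hB
      rw [hsplit]
      convert this using 1
      rw [map_sub, map_smul]
      push_cast
      module

/-- A vector in the ladder annihilated by all lowering operators lies in the base. -/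
theorem mem_base_of_annihilated (hε : ε * ε = 1) (hS : ∀ m, ∀ u ∈ S, Y m u = 0)
    (hYX : ∀ m j u, Y m (X j u) = ε • X j (Y m u) + I (m - j) u)
    (hJ : ∀ n u, ∑ i ∈ Finset.range (n + 1), J i (I (i - n) u) = if n = 0 then u else 0)
    (hpos : ∀ d k i n, ∀ u ∈ ladder X S (d + 1), 0 < n →
      X k (J i (I n u)) ∈ ladder X S (d + 1))
    (hcomm : ∀ d k i j m, ∀ u ∈ ladder X S (d + 1),
      X k (J i (X j (Y m u))) - ε • X j (X k (J i (Y m u))) ∈ ladder X S (d + 1))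
    (d : ℕ) {w : E} (hw : w ∈ ladder X S (d + 1)) (hY : ∀ m, Y m w = 0) : w ∈ S := by
  induction d with
  | zero => exact hw
  | succ d ih =>
    obtain ⟨K, hK⟩ := counter_sub_mem hε hS hYX hJ hpos hcomm (d + 1) hw
    have := hK K le_rfl
    rw [counter_apply] at this
    simp only [hY, map_zero, Finset.sum_const_zero, zero_sub, neg_mem_iff] at this
    exact ih ((Submodule.smul_mem_iff _ (by exact_mod_cast d.succ_ne_zero)).1 this)

end Descent

section Singular

variable {E : Type*} [AddCommGroup E] [Module ℂ E] {L I G : ℤ → E →ₗ[ℂ] E} {h c : ℂ} {x : E}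

theorem Relations.i_l (hr : Relations L I G) (m n : ℤ) (u : E) :
    I m (L n u) = L n (I m u) - (m : ℂ) • I (m + n) u := by
  rw [hr.li, add_comm n m]
  abel

theorem Relations.g_l (hr : Relations L I G) (m n : ℤ) (u : E) :
    G m (L n u) = L n (G m u) - (m : ℂ) • G (m + n) u := by
  rw [hr.lg, add_comm n m]
  abel

theorem Relations.g_i (hr : Relations L I G) (m n : ℤ) (u : E) :
    G m (I n u) = I n (G m u) := (hr.ig n m u).symm

theorem Relations.g_zero_sq (hr : Relations L I G) (u : E) : G 0 (G 0 u) = I 0 u := by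
  have h1 := hr.gg 0 0 u
  have h2 : (2 : ℂ) • G 0 (G 0 u) = (2 : ℂ) • I 0 u := by
    rw [two_smul]
    nth_rewrite 1 [h1]
    simp
  exact smul_right_injective E (two_ne_zero (α := ℂ)) h2

namespace HighestWeight

theorem l_g_zero (hr : Relations L I G) (hx : HighestWeight L I G h c x) {m : ℤ} (hm : 0 < m) :
    L m (G 0 x) = 0 := by
  simp [hr.lg, hx.l_pos m hm]

theorem i_g_zero (hr : Relations L I G) (hx : HighestWeight L I G h c x) {m : ℤ} (hm : 0 < m) :
    I m (G 0 x) = 0 := by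
  simp [hr.ig, hx.i_pos m hm]

theorem g_g_zero (hr : Relations L I G) (hx : HighestWeight L I G h c x) {m : ℤ} (hm : 0 < m) :
    G m (G 0 x) = 0 := by
  simp [hr.gg, hx.g_pos m hm, hx.i_pos m hm]

end HighestWeight

/-- The family of all mode operators. -/
def modes (L I G : ℤ → E →ₗ[ℂ] E) : SB → E →ₗ[ℂ] E
  | .l m => L m
  | .i m => I m
  | .g m => G m

/-- The operators `I n` and `G n`. -/
def currents (I G : ℤ → E →ₗ[ℂ] E) : ℤ ⊕ ℤ → E →ₗ[ℂ] E := Sum.elim I G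

theorem i_zero_eq_smul (hr : Relations L I G) (hx : HighestWeight L I G h c x)
    (hgen : generated (modes L I G) {x} = ⊤) (u : E) : I 0 u = c • u := by
  have hle : generated (modes L I G) {x} ≤ LinearMap.eqLocus (I 0) (c • LinearMap.id) := by
    refine generated_le (by simpa using hx.i_zero) ?_
    rintro (m | m | m) u hu
    · have : I 0 u = c • u := hu
      change I 0 (L m u) = c • L m u
      simp [hr.i_l, this]
    · have : I 0 u = c • u := hu
      change I 0 (I m u) = c • I m u
      simp [hr.ii 0 m, this]
    · have : I 0 u = c • u := hu
      change I 0 (G m u) = c • G m u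
      simp [hr.ig, this]
  exact hle (hgen ▸ Submodule.mem_top : u ∈ _)

section Virasoro

local notation "P" => generated (currents I G) (Singleton.singleton x)

theorem currents_i_mem (n : ℤ) {u : E} (hu : u ∈ P) : I n u ∈ P :=
  generated_stable (currents I G) {x} (Sum.inl n) hu

theorem currents_g_mem (n : ℤ) {u : E} (hu : u ∈ P) : G n u ∈ P :=
  generated_stable (currents I G) {x} (Sum.inr n) hu

theorem currents_l_mem (hr : Relations L I G) (hx : HighestWeight L I G h c x) {n : ℤ}
    (hn : 0 ≤ n) {u : E} (hu : u ∈ P) : L n u ∈ P := by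
  suffices H : P ≤ P ⊓ (P).comap (L n) from (H hu).2
  refine generated_le (Set.singleton_subset_iff.2 ?_) ?_
  · refine ⟨subset_generated _ _ rfl, ?_⟩
    change L n x ∈ P
    rcases hn.eq_or_lt with rfl | hn
    · rw [hx.l_zero]
      exact Submodule.smul_mem _ _ (subset_generated _ _ rfl)
    · simp [hx.l_pos n hn]
  · rintro (m | m) u ⟨hu, hL⟩
    · refine ⟨currents_i_mem m hu, ?_⟩
      change L n (I m u) ∈ P
      rw [hr.li]
      exact Submodule.add_mem _ (currents_i_mem m hL)
        (Submodule.smul_mem _ _ (currents_i_mem _ hu))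
    · refine ⟨currents_g_mem m hu, ?_⟩
      change L n (G m u) ∈ P
      rw [hr.lg]
      exact Submodule.add_mem _ (currents_g_mem m hL)
        (Submodule.smul_mem _ _ (currents_g_mem _ hu))

theorem currents_i_pos (hr : Relations L I G) (hx : HighestWeight L I G h c x) {n : ℤ}
    (hn : 0 < n) {u : E} (hu : u ∈ P) : I n u = 0 := by
  suffices H : P ≤ LinearMap.ker (I n) from H hu
  refine generated_le (by simpa using hx.i_pos n hn) ?_
  rintro (m | m) u hu
  · have : I n u = 0 := hu
    change I n (I m u) = 0
    simp [hr.ii n m, this]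
  · have : I n u = 0 := hu
    change I n (G m u) = 0
    simp [hr.ig n m, this]

local notation "Λ" => ladder (fun k : ℕ => L (-(k + 1))) P

theorem virasoro_ladder_i (hr : Relations L I G) (n : ℤ) {d : ℕ} {u : E} (hu : u ∈ Λ d) :
    I n u ∈ Λ d := by
  suffices H : ∀ d, Λ d ≤ ⨅ n, (Λ d).comap (I n) from (Submodule.mem_iInf _).1 (H d hu) n
  intro d
  induction d with
  | zero => exact bot_le
  | succ d ih =>
    rcases d with _ | d
    · exact fun u hu => (Submodule.mem_iInf _).2 fun n => currents_i_mem n hu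
    · refine ladder_succ_le (fun u hu => (Submodule.mem_iInf _).2 fun n =>
        ladder_mono (Nat.le_succ _) ((Submodule.mem_iInf _).1 (ih hu) n)) fun k u hu =>
        (Submodule.mem_iInf _).2 fun n => ?_
      have hI := fun n => (Submodule.mem_iInf _).1 (ih hu) n
      change I n (L _ u) ∈ Λ (d + 2)
      rw [hr.i_l]
      exact Submodule.sub_mem _ (ladder_raise k (hI n))
        (Submodule.smul_mem _ _ (ladder_mono (Nat.le_succ _) (hI _)))

theorem virasoro_ladder_g (hr : Relations L I G) (n : ℤ) {d : ℕ} {u : E} (hu : u ∈ Λ d) :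
    G n u ∈ Λ d := by
  suffices H : ∀ d, Λ d ≤ ⨅ n, (Λ d).comap (G n) from (Submodule.mem_iInf _).1 (H d hu) n
  intro d
  induction d with
  | zero => exact bot_le
  | succ d ih =>
    rcases d with _ | d
    · exact fun u hu => (Submodule.mem_iInf _).2 fun n => currents_g_mem n hu
    · refine ladder_succ_le (fun u hu => (Submodule.mem_iInf _).2 fun n =>
        ladder_mono (Nat.le_succ _) ((Submodule.mem_iInf _).1 (ih hu) n)) fun k u hu =>
        (Submodule.mem_iInf _).2 fun n => ?_
      have hI := fun n => (Submodule.mem_iInf _).1 (ih hu) n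
      change G n (L _ u) ∈ Λ (d + 2)
      rw [hr.g_l]
      exact Submodule.sub_mem _ (ladder_raise k (hI n))
        (Submodule.smul_mem _ _ (ladder_mono (Nat.le_succ _) (hI _)))

theorem virasoro_ladder_i_pos (hr : Relations L I G) (hx : HighestWeight L I G h c x) {n : ℤ}
    (hn : 0 < n) {d : ℕ} {u : E} (hu : u ∈ Λ (d + 1)) : I n u ∈ Λ d := by
  refine ladder_lower (I n) (fun u hu => currents_i_pos hr hx hn hu) (fun d k u hu hI => ?_) d hu
  rw [hr.i_l]
  exact Submodule.sub_mem _ (ladder_raise k hI)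
    (Submodule.smul_mem _ _ (virasoro_ladder_i hr _ hu))

theorem virasoro_ladder_l (hr : Relations L I G) (hx : HighestWeight L I G h c x) (n : ℤ)
    {d : ℕ} {u : E} (hu : u ∈ Λ d) : L n u ∈ Λ (d + 1) := by
  suffices H : ∀ d, Λ d ≤ ⨅ n, (Λ (d + 1)).comap (L n) from
    (Submodule.mem_iInf _).1 (H d hu) n
  intro d
  induction d with
  | zero => exact bot_le
  | succ d ih =>
    rcases d with _ | d
    · refine fun u hu => (Submodule.mem_iInf _).2 fun n => ?_
      change L n u ∈ Λ 2
      rcases le_or_gt 0 n with hn | hn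
      · exact ladder_mono (Nat.le_succ 1) (currents_l_mem hr hx hn hu)
      · obtain ⟨k, rfl⟩ : ∃ k : ℕ, n = -(k + 1) := ⟨(-n - 1).toNat, by omega⟩
        exact ladder_raise (d := 1) (X := fun k : ℕ => L (-(k + 1))) k hu
    · refine ladder_succ_le (fun u hu => (Submodule.mem_iInf _).2 fun n =>
        ladder_mono (Nat.le_succ (d + 2)) ((Submodule.mem_iInf _).1 (ih hu) n)) fun k u hu =>
        (Submodule.mem_iInf _).2 fun n => ?_
      have hI := fun n => (Submodule.mem_iInf _).1 (ih hu) n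
      change L n (L _ u) ∈ Λ (d + 3)
      rw [hr.ll]
      exact Submodule.add_mem _ (ladder_raise k (hI n))
        (Submodule.smul_mem _ _ (ladder_mono (Nat.le_succ _) (hI _)))

/-- A vector annihilated by all `I m`, `m > 0`, lies in the submodule generated by the
currents. -/
theorem mem_currents_of_annihilated (hr : Relations L I G) (hx : HighestWeight L I G h c x)
    (hc : c ≠ 0) (hgen : generated (modes L I G) {x} = ⊤) {w : E}
    (hw : ∀ m, 0 < m → I m w = 0) : w ∈ P := by
  obtain ⟨d, hd⟩ : ∃ d, w ∈ Λ (d + 1) := by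
    refine exists_mem_ladder (κ := SB) (A := modes L I G) (B := {x}) (subset_generated _ _) ?_
      (hgen ▸ Submodule.mem_top : w ∈ _)
    rintro (m | m | m) d u hu
    · exact ⟨_, virasoro_ladder_l hr hx m hu⟩
    · exact ⟨_, virasoro_ladder_i hr m hu⟩
    · exact ⟨_, virasoro_ladder_g hr m hu⟩
  refine mem_base_of_annihilated (X := fun k : ℕ => L (-(k + 1)))
    (Y := fun m : ℕ => (-(m + 1 : ℂ))⁻¹ • I (m + 1)) (J := invCoeff I c) (I := I) (ε := 1)
    (by simp) (fun m u hu => ?_) (fun m j u => ?_)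
    (sum_invCoeff hc (i_zero_eq_smul hr hx hgen)) (fun d k i n u hu hn => ?_)
    (fun d k i j m u hu => ?_) d hd (fun m => ?_)
  · simp [currents_i_pos hr hx (by omega : (0 : ℤ) < m + 1) hu]
  · have hm : (m + 1 : ℂ) ≠ 0 := by exact_mod_cast m.succ_ne_zero
    have e : (m : ℤ) + 1 + -(j + 1) = m - j := by ring
    simp only [LinearMap.smul_apply, hr.i_l, e, map_smul, smul_sub, smul_smul]
    push_cast
    rw [inv_neg, neg_mul, inv_mul_cancel₀ hm]
    module
  · exact ladder_raise k (invCoeff_mem (R := Λ d) (fun n u hu => virasoro_ladder_i hr n hu) i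
      (virasoro_ladder_i_pos hr hx hn hu))
  · have hI : ∀ d n, ∀ u ∈ Λ d, I n u ∈ Λ d := fun d n u hu => virasoro_ladder_i hr n hu
    suffices H : ∀ s ∈ Λ d, L (-(k + 1)) (invCoeff I c i (L (-(j + 1)) s)) -
        (1 : ℂ) • L (-(j + 1)) (L (-(k + 1)) (invCoeff I c i s)) ∈ Λ (d + 1) from
      H _ (Submodule.smul_mem _ _ (virasoro_ladder_i_pos hr hx (by omega) hu))
    intro s hs
    have h1 : invCoeff I c i (L (-(j + 1)) s) - L (-(j + 1)) (invCoeff I c i s) ∈ Λ d := by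
      refine invCoeff_comm_mem _ (hI d) (fun n u hu => ?_) i hs
      rw [hr.i_l, sub_sub_cancel_left]
      exact Submodule.neg_mem _ (Submodule.smul_mem _ _ (hI d _ u hu))
    have h2 := virasoro_ladder_l hr hx (-(k + 1) + -(j + 1)) (invCoeff_mem (hI d) i hs (c := c))
    have h3 := Submodule.add_mem _
      (ladder_raise (X := fun k : ℕ => L (-(k + 1))) k h1)
      (Submodule.smul_mem _ (((-(j + 1) : ℤ) : ℂ) - ((-(k + 1) : ℤ) : ℂ)) h2)
    convert h3 using 1
    rw [map_sub, hr.ll (-(k + 1)) (-(j + 1)), one_smul]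
    abel
  · simp [hw (m + 1) (by omega)]

end Virasoro

section Fermionic

local notation "Q" => generated I {x, G 0 x}

local notation "Λ" => ladder (fun k : ℕ => G (-(k + 1))) Q

theorem heisenberg_i_pos (hr : Relations L I G) (hx : HighestWeight L I G h c x) {n : ℤ}
    (hn : 0 < n) {u : E} (hu : u ∈ Q) : I n u = 0 := by
  suffices H : Q ≤ LinearMap.ker (I n) from H hu
  refine generated_le ?_ fun m u hu => ?_
  · rintro _ (rfl | rfl)
    · exact hx.i_pos n hn
    · exact hx.i_g_zero hr hn
  · have : I n u = 0 := hu
    change I n (I m u) = 0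
    simp [hr.ii n m, this]

theorem heisenberg_g_pos (hr : Relations L I G) (hx : HighestWeight L I G h c x) {n : ℤ}
    (hn : 0 < n) {u : E} (hu : u ∈ Q) : G n u = 0 := by
  suffices H : Q ≤ LinearMap.ker (G n) from H hu
  refine generated_le ?_ fun m u hu => ?_
  · rintro _ (rfl | rfl)
    · exact hx.g_pos n hn
    · exact hx.g_g_zero hr hn
  · have : G n u = 0 := hu
    change G n (I m u) = 0
    simp [hr.g_i n m, this]

theorem heisenberg_g_zero (hr : Relations L I G) {u : E} (hu : u ∈ Q) : G 0 u ∈ Q := by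
  suffices H : Q ≤ (Q).comap (G 0) from H hu
  refine generated_le ?_ fun m u hu => ?_
  · rintro _ (rfl | rfl)
    · exact subset_generated _ _ (by simp)
    · change G 0 (G 0 _) ∈ Q
      rw [hr.g_zero_sq]
      exact generated_stable _ _ _ (subset_generated _ _ (by simp))
  · change G 0 (I m u) ∈ Q
    rw [hr.g_i]
    exact generated_stable _ _ _ hu

theorem fermionic_ladder_i (hr : Relations L I G) (n : ℤ) {d : ℕ} {u : E} (hu : u ∈ Λ d) :
    I n u ∈ Λ d := by
  refine ladder_shift (I n) 0 (fun u hu => generated_stable I _ n hu)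
    (fun d k u hu hI => ?_) d hu
  rw [hr.ig]
  exact ladder_raise k hI

theorem fermionic_ladder_i_pos (hr : Relations L I G) (hx : HighestWeight L I G h c x) {n : ℤ}
    (hn : 0 < n) {d : ℕ} {u : E} (hu : u ∈ Λ d) : I n u = 0 := by
  refine ladder_eq_zero (I n) (fun u hu => heisenberg_i_pos hr hx hn hu)
    (fun k u hu => ?_) d hu
  rw [hr.ig, hu, map_zero]

theorem fermionic_ladder_g (hr : Relations L I G) (hx : HighestWeight L I G h c x) (n : ℤ)
    {d : ℕ} {u : E} (hu : u ∈ Λ d) : G n u ∈ Λ (d + 1) := by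
  refine ladder_shift (G n) 1 (fun u hu => ?_) (fun d k u hu hG => ?_) d hu
  · rcases lt_trichotomy n 0 with hn | rfl | hn
    · obtain ⟨k, rfl⟩ : ∃ k : ℕ, n = -(k + 1) := ⟨(-n - 1).toNat, by omega⟩
      exact ladder_raise (d := 1) (X := fun k : ℕ => G (-(k + 1))) k hu
    · exact ladder_mono (Nat.le_succ 1) (heisenberg_g_zero hr hu)
    · simp [heisenberg_g_pos hr hx hn hu]
  · rw [hr.gg]
    exact Submodule.add_mem _ (Submodule.neg_mem _ (ladder_raise k hG))
      (Submodule.smul_mem _ _ (ladder_mono (by omega) (fermionic_ladder_i hr _ hu)))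

theorem fermionic_ladder_g_pos (hr : Relations L I G) (hx : HighestWeight L I G h c x) {n : ℤ}
    (hn : 0 < n) {d : ℕ} {u : E} (hu : u ∈ Λ (d + 1)) : G n u ∈ Λ d := by
  refine ladder_lower (G n) (fun u hu => heisenberg_g_pos hr hx hn hu)
    (fun d k u hu hG => ?_) d hu
  rw [hr.gg]
  exact Submodule.add_mem _ (Submodule.neg_mem _ (ladder_raise k hG))
    (Submodule.smul_mem _ _ (fermionic_ladder_i hr _ hu))

/-- A vector generated by the currents and annihilated by all `G m`, `m > 0`, is generated
by the operators `I n` from the top space. -/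
theorem mem_heisenberg_of_annihilated (hr : Relations L I G) (hx : HighestWeight L I G h c x)
    (hc : c ≠ 0) (hI0 : ∀ u, I 0 u = c • u) {w : E} (hwP : w ∈ generated (currents I G) {x})
    (hw : ∀ m, 0 < m → G m w = 0) : w ∈ Q := by
  obtain ⟨d, hd⟩ : ∃ d, w ∈ Λ (d + 1) := by
    refine exists_mem_ladder ?_ ?_ hwP
    · rintro _ rfl
      exact subset_generated _ _ (by simp)
    · rintro (m | m) d u hu
      · exact ⟨_, fermionic_ladder_i hr m hu⟩
      · exact ⟨_, fermionic_ladder_g hr hx m hu⟩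
  refine mem_base_of_annihilated (X := fun k : ℕ => G (-(k + 1)))
    (Y := fun m : ℕ => (2 : ℂ)⁻¹ • G (m + 1)) (J := invCoeff I c) (I := I) (ε := -1)
    (by simp) (fun m u hu => ?_) (fun m j u => ?_)
    (sum_invCoeff hc hI0) (fun d k i n u hu hn => ?_)
    (fun d k i j m u hu => ?_) d hd (fun m => ?_)
  · rw [LinearMap.smul_apply, heisenberg_g_pos hr hx (by omega) hu, smul_zero]
  · have e : (m : ℤ) + 1 + -(j + 1) = m - j := by ring
    rw [LinearMap.smul_apply, LinearMap.smul_apply, hr.gg, e, map_smul, smul_add, smul_smul,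
      inv_mul_cancel₀ two_ne_zero, one_smul, neg_one_smul, smul_neg]
  · simp [fermionic_ladder_i_pos hr hx hn hu]
  · suffices H : ∀ s ∈ Λ d, G (-(k + 1)) (invCoeff I c i (G (-(j + 1)) s)) -
        (-1 : ℂ) • G (-(j + 1)) (G (-(k + 1)) (invCoeff I c i s)) ∈ Λ (d + 1) from
      H _ (Submodule.smul_mem _ _ (fermionic_ladder_g_pos hr hx (by omega) hu))
    intro s hs
    have hI : ∀ n, ∀ u ∈ Λ d, I n u ∈ Λ d := fun n u hu => fermionic_ladder_i hr n hu
    have h1 : (2 : ℂ) • I (-(k + 1) + -(j + 1)) (invCoeff I c i s) ∈ Λ d :=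
      Submodule.smul_mem _ _ (hI _ _ (invCoeff_mem hI i hs))
    rw [invCoeff_comm (G (-(j + 1))) (fun n u => hr.ig n _ u), hr.gg (-(k + 1)) (-(j + 1))]
    convert ladder_mono d.le_succ h1 using 1
    module
  · simp [hw (m + 1) (by omega)]

end Fermionic

section Heisenberg

local notation "D" => Submodule.span ℂ {x, G 0 x}

local notation "Λ" => ladder (fun k : ℕ => (-(k + 1 : ℂ))⁻¹ • I (-(k + 1))) D

theorem heisenberg_ladder_i_pos (hr : Relations L I G) (hx : HighestWeight L I G h c x) {n : ℤ}
    (hn : 0 < n) {d : ℕ} {u : E} (hu : u ∈ Λ d) : I n u = 0 := by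
  refine ladder_eq_zero (I n) (fun u hu => ?_) (fun k u hu => ?_) d hu
  · refine (Submodule.span_le (p := LinearMap.ker (I n))).2 ?_ hu
    rintro _ (rfl | rfl)
    · exact hx.i_pos n hn
    · exact hx.i_g_zero hr hn
  · rw [LinearMap.smul_apply, map_smul, hr.ii, hu, map_zero, smul_zero]

/-- A vector generated by the operators `I n` from the top space and annihilated by all `L m`,
`m > 0`, lies in the top space. -/
theorem mem_top_space_of_annihilated (hr : Relations L I G) (hx : HighestWeight L I G h c x)
    (hc : c ≠ 0) (hI0 : ∀ u, I 0 u = c • u) {w : E} (hwQ : w ∈ generated I {x, G 0 x})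
    (hw : ∀ m, 0 < m → L m w = 0) : w ∈ Submodule.span ℂ {x, G 0 x} := by
  obtain ⟨d, hd⟩ : ∃ d, w ∈ Λ (d + 1) := by
    refine exists_mem_ladder Submodule.subset_span (fun n d u hu => ?_) hwQ
    rcases lt_trichotomy n 0 with hn | rfl | hn
    · obtain ⟨k, rfl⟩ : ∃ k : ℕ, n = -(k + 1) := ⟨(-n - 1).toNat, by omega⟩
      refine ⟨d + 1, ?_⟩
      have h1 := Submodule.smul_mem _ (-(k + 1 : ℂ)) (ladder_raise k hu)
      have hk : (-(k + 1 : ℂ)) ≠ 0 := neg_ne_zero.2 (by exact_mod_cast k.succ_ne_zero)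
      rwa [LinearMap.smul_apply, smul_inv_smul₀ hk] at h1
    · exact ⟨d, by rw [hI0]; exact Submodule.smul_mem _ _ hu⟩
    · exact ⟨d, by simp [heisenberg_ladder_i_pos hr hx hn hu]⟩
  refine mem_base_of_annihilated (X := fun k : ℕ => (-(k + 1 : ℂ))⁻¹ • I (-(k + 1)))
    (Y := fun m : ℕ => L (m + 1)) (J := invCoeff I c) (I := I) (ε := 1)
    (by simp) (fun m u hu => ?_) (fun m j u => ?_)
    (sum_invCoeff hc hI0) (fun d k i n u hu hn => ?_)
    (fun d k i j m u hu => ?_) d hd (fun m => hw _ (by omega))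
  · refine (Submodule.span_le (p := LinearMap.ker (L (m + 1)))).2 ?_ hu
    rintro _ (rfl | rfl)
    · exact hx.l_pos _ (by omega)
    · exact hx.l_g_zero hr (by omega)
  · have e : (m : ℤ) + 1 + -(j + 1) = m - j := by ring
    have hj : (-(j + 1 : ℂ)) ≠ 0 := neg_ne_zero.2 (by exact_mod_cast j.succ_ne_zero)
    have e' : ((-(j + 1) : ℤ) : ℂ) = -(j + 1 : ℂ) := by push_cast; ring
    rw [LinearMap.smul_apply, map_smul, hr.li, e, e', smul_add, inv_smul_smul₀ hj, one_smul,
      LinearMap.smul_apply]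
  · simp [heisenberg_ladder_i_pos hr hx hn hu]
  · have hcom := fun n u => invCoeff_comm (c := c) (I n) (fun a u => hr.ii a n u) i u
    simp only [LinearMap.smul_apply, map_smul, hcom, one_smul, hr.ii (-(j + 1)) (-(k + 1))]
    rw [smul_comm, sub_self]
    exact Submodule.zero_mem _

end Heisenberg

section Weight

variable (L I G x) in
/-- Vectors obtained from the top space by raising operators of total degree at most `n`. -/
inductive WeightLE : ℤ → E → Prop
  | base {n : ℤ} (hn : 0 ≤ n) : WeightLE n x
  | base_g {n : ℤ} (hn : 0 ≤ n) : WeightLE n (G 0 x)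
  | l {n : ℤ} {u : E} (k : ℤ) (hk : k < 0) (hu : WeightLE n u) : WeightLE (n - k) (L k u)
  | i {n : ℤ} {u : E} (k : ℤ) (hk : k < 0) (hu : WeightLE n u) : WeightLE (n - k) (I k u)
  | g {n : ℤ} {u : E} (k : ℤ) (hk : k < 0) (hu : WeightLE n u) : WeightLE (n - k) (G k u)

theorem WeightLE.nonneg {n : ℤ} {u : E} (hu : WeightLE L I G x n u) : 0 ≤ n := by
  induction hu <;> omega

theorem WeightLE.mono {n n' : ℤ} {u : E} (hu : WeightLE L I G x n u) (hn : n ≤ n') :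
    WeightLE L I G x n' u := by
  induction hu generalizing n' with
  | base h => exact .base (h.trans hn)
  | base_g h => exact .base_g (h.trans hn)
  | l k hk _ ih =>
    have := (ih (n' := n' + k) (by omega)).l k hk
    rwa [add_sub_cancel_right] at this
  | i k hk _ ih =>
    have := (ih (n' := n' + k) (by omega)).i k hk
    rwa [add_sub_cancel_right] at this
  | g k hk _ ih =>
    have := (ih (n' := n' + k) (by omega)).g k hk
    rwa [add_sub_cancel_right] at this

variable (L I G x) in
/-- The span of the vectors of depth at most `n`. -/
def weightSpace (n : ℤ) : Submodule ℂ E := Submodule.span ℂ {u | WeightLE L I G x n u}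

local notation "W" => weightSpace L I G x

theorem weightSpace_mono : Monotone W := fun _ _ hn =>
  Submodule.span_mono fun _ hu => hu.mono hn

theorem eq_zero_of_mem_weightSpace {n : ℤ} (hn : n < 0) {u : E} (hu : u ∈ W n) : u = 0 := by
  have : {u | WeightLE L I G x n u} = ∅ := by
    ext u
    exact iff_of_false (fun hu => absurd (WeightLE.nonneg hu) (not_le.2 hn)) (by simp)
  rw [weightSpace, this, Submodule.span_empty] at hu
  exact hu

theorem map_mem_weightSpace {A : E →ₗ[ℂ] E} {n n' : ℤ}
    (hA : ∀ u, WeightLE L I G x n u → A u ∈ W n') {u : E} (hu : u ∈ W n) : A u ∈ W n' :=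
  (Submodule.span_le (p := (W n').comap A)).2 hA hu

theorem weightLE_act (hr : Relations L I G) (hx : HighestWeight L I G h c x) {n : ℤ} {u : E}
    (hu : WeightLE L I G x n u) (k : ℤ) :
    L k u ∈ W (n - k) ∧ I k u ∈ W (n - k) ∧ G k u ∈ W (n - k) := by
  have hL : ∀ {j n : ℤ} {u : E}, j < 0 → u ∈ W n → L j u ∈ W (n - j) := fun hj hu =>
    map_mem_weightSpace (fun u hu => Submodule.subset_span (hu.l _ hj)) hu
  have hI : ∀ {j n : ℤ} {u : E}, j < 0 → u ∈ W n → I j u ∈ W (n - j) := fun hj hu =>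
    map_mem_weightSpace (fun u hu => Submodule.subset_span (hu.i _ hj)) hu
  have hG : ∀ {j n : ℤ} {u : E}, j < 0 → u ∈ W n → G j u ∈ W (n - j) := fun hj hu =>
    map_mem_weightSpace (fun u hu => Submodule.subset_span (hu.g _ hj)) hu
  have hb : ∀ {n : ℤ}, 0 ≤ n → x ∈ W n := fun hn => Submodule.subset_span (.base hn)
  have hb' : ∀ {n : ℤ}, 0 ≤ n → G 0 x ∈ W n := fun hn => Submodule.subset_span (.base_g hn)
  induction hu generalizing k with
  | @base n hn =>
    rcases lt_trichotomy k 0 with hk | rfl | hk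
    · exact ⟨hL hk (hb hn), hI hk (hb hn), hG hk (hb hn)⟩
    · rw [hx.l_zero, hx.i_zero, sub_zero]
      exact ⟨Submodule.smul_mem _ _ (hb hn), Submodule.smul_mem _ _ (hb hn), hb' hn⟩
    · simp [hx.l_pos k hk, hx.i_pos k hk, hx.g_pos k hk]
  | @base_g n hn =>
    rcases lt_trichotomy k 0 with hk | rfl | hk
    · exact ⟨hL hk (hb' hn), hI hk (hb' hn), hG hk (hb' hn)⟩
    · rw [hr.lg, hr.ig, hr.g_zero_sq, hx.l_zero, hx.i_zero, sub_zero, map_smul, map_smul]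
      simp only [Int.cast_zero, zero_smul, add_zero]
      exact ⟨Submodule.smul_mem _ _ (hb' hn), Submodule.smul_mem _ _ (hb' hn),
        Submodule.smul_mem _ _ (hb hn)⟩
    · simp [hx.l_g_zero hr hk, hx.i_g_zero hr hk, hx.g_g_zero hr hk]
  | @l n u j hj _ ih =>
    have e : n - (k + j) = n - j - k := by ring
    have e' : n - k - j = n - j - k := by ring
    obtain ⟨h1, h2, h3⟩ := ih k
    obtain ⟨i1, i2, i3⟩ := ih (k + j)
    rw [e] at i1 i2 i3
    have h1 := hL hj h1
    have h2 := hL hj h2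
    have h3 := hL hj h3
    rw [e'] at h1 h2 h3
    rw [hr.ll, hr.i_l, hr.g_l]
    exact ⟨Submodule.add_mem _ h1 (Submodule.smul_mem _ _ i1),
      Submodule.sub_mem _ h2 (Submodule.smul_mem _ _ i2),
      Submodule.sub_mem _ h3 (Submodule.smul_mem _ _ i3)⟩
  | @i n u j hj _ ih =>
    have e : n - (k + j) = n - j - k := by ring
    have e' : n - k - j = n - j - k := by ring
    obtain ⟨h1, h2, h3⟩ := ih k
    obtain ⟨i1, i2, i3⟩ := ih (k + j)
    rw [e] at i1 i2 i3
    have h1 := hI hj h1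
    have h2 := hI hj h2
    have h3 := hI hj h3
    rw [e'] at h1 h2 h3
    rw [hr.li, hr.ii, hr.g_i]
    exact ⟨Submodule.add_mem _ h1 (Submodule.smul_mem _ _ i2), h2, h3⟩
  | @g n u j hj _ ih =>
    have e : n - (k + j) = n - j - k := by ring
    have e' : n - k - j = n - j - k := by ring
    obtain ⟨h1, h2, h3⟩ := ih k
    obtain ⟨i1, i2, i3⟩ := ih (k + j)
    rw [e] at i1 i2 i3
    have h1 := hG hj h1
    have h2 := hG hj h2
    have h3 := hG hj h3
    rw [e'] at h1 h2 h3
    rw [hr.lg, hr.ig, hr.gg]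
    exact ⟨Submodule.add_mem _ h1 (Submodule.smul_mem _ _ i3), h2,
      Submodule.add_mem _ (Submodule.neg_mem _ h3) (Submodule.smul_mem _ _ i2)⟩

theorem exists_mem_weightSpace (hr : Relations L I G) (hx : HighestWeight L I G h c x)
    (hgen : generated (modes L I G) {x} = ⊤) (u : E) : ∃ n : ℕ, u ∈ W n := by
  have hdir : Directed (· ≤ ·) W := weightSpace_mono.directed_le
  have hle : generated (modes L I G) {x} ≤ ⨆ n, W n := by
    refine generated_le ?_ fun a u hu => ?_
    · rintro _ rfl
      exact Submodule.mem_iSup_of_mem 0 (Submodule.subset_span (.base le_rfl))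
    · obtain ⟨n, hn⟩ := (Submodule.mem_iSup_of_directed _ hdir).1 hu
      rcases a with m | m | m <;> refine Submodule.mem_iSup_of_mem (n - m) ?_
      · exact map_mem_weightSpace (fun u hu => (weightLE_act hr hx hu m).1) hn
      · exact map_mem_weightSpace (fun u hu => (weightLE_act hr hx hu m).2.1) hn
      · exact map_mem_weightSpace (fun u hu => (weightLE_act hr hx hu m).2.2) hn
  obtain ⟨n, hn⟩ := (Submodule.mem_iSup_of_directed _ hdir).1
    (hle (hgen ▸ Submodule.mem_top : u ∈ _))
  exact ⟨n.toNat, weightSpace_mono (Int.self_le_toNat n) hn⟩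

/-- A nonzero subspace stable under the positive modes contains a nonzero singular vector. -/
theorem exists_singular (hr : Relations L I G) (hx : HighestWeight L I G h c x)
    (hgen : generated (modes L I G) {x} = ⊤) {U : Submodule ℂ E} (hU : U ≠ ⊥)
    (hstab : ∀ m, ∀ u ∈ U, L m u ∈ U ∧ I m u ∈ U ∧ G m u ∈ U) :
    ∃ w ∈ U, w ≠ 0 ∧ ∀ m, 0 < m → L m w = 0 ∧ I m w = 0 ∧ G m w = 0 := by
  classical
  have hex : ∃ n : ℕ, ∃ w ∈ U, w ≠ 0 ∧ w ∈ W n := by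
    obtain ⟨w, hw, h0⟩ := Submodule.exists_mem_ne_zero_of_ne_bot hU
    obtain ⟨n, hn⟩ := exists_mem_weightSpace hr hx hgen w
    exact ⟨n, w, hw, h0, hn⟩
  obtain ⟨w, hw, h0, hn⟩ := Nat.find_spec hex
  refine ⟨w, hw, h0, fun m hm => ?_⟩
  have key : ∀ y ∈ U, y ∈ W (Nat.find hex - m) → y = 0 := by
    intro y hy hyW
    by_contra hy0
    rcases lt_or_ge ((Nat.find hex : ℤ) - m) 0 with hneg | hnn
    · exact hy0 (eq_zero_of_mem_weightSpace hneg hyW)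
    · refine Nat.find_min hex (m := ((Nat.find hex : ℤ) - m).toNat) (by omega)
        ⟨y, hy, hy0, ?_⟩
      rwa [Int.toNat_of_nonneg hnn]
  obtain ⟨s1, s2, s3⟩ := hstab m w hw
  exact ⟨key _ s1 (map_mem_weightSpace (fun u hu => (weightLE_act hr hx hu m).1) hn),
    key _ s2 (map_mem_weightSpace (fun u hu => (weightLE_act hr hx hu m).2.1) hn),
    key _ s3 (map_mem_weightSpace (fun u hu => (weightLE_act hr hx hu m).2.2) hn)⟩

/-- A nonzero stable subspace of a highest weight module with `c ≠ 0` meets the top space. -/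
theorem exists_mem_top_space (hr : Relations L I G) (hx : HighestWeight L I G h c x)
    (hc : c ≠ 0) (hgen : generated (modes L I G) {x} = ⊤) {U : Submodule ℂ E} (hU : U ≠ ⊥)
    (hstab : ∀ m, ∀ u ∈ U, L m u ∈ U ∧ I m u ∈ U ∧ G m u ∈ U) :
    ∃ w ∈ U, w ≠ 0 ∧ w ∈ Submodule.span ℂ {x, G 0 x} := by
  obtain ⟨w, hw, h0, hs⟩ := exists_singular hr hx hgen hU hstab
  have hI0 := i_zero_eq_smul hr hx hgen
  have h1 := mem_currents_of_annihilated hr hx hc hgen fun m hm => (hs m hm).2.1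
  have h2 := mem_heisenberg_of_annihilated hr hx hc hI0 h1 fun m hm => (hs m hm).2.2
  exact ⟨w, hw, h0, mem_top_space_of_annihilated hr hx hc hI0 h2 fun m hm => (hs m hm).1⟩

end Weight

end Singular

section Modules

variable {Q : Set SB} {ρ : GRep Q} {M : GRep (Set.univ : Set SB)} {ι : ρ.V →ₗ[ℂ] M.V}

theorem relations_act (M : GRep (Set.univ : Set SB)) :
    Relations (fun m => M.act (.l m)) (fun m => M.act (.i m)) (fun m => M.act (.g m)) where
  ll m n u := by
    have := M.act_br (.l m) trivial (.l n) trivial u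
    rw [sub_eq_iff_eq_add', sb, Finsupp.sum_smul_index (by simp)] at this
    simpa [sgn, par, Finsupp.sum_single_index] using this
  li m n u := by
    have := M.act_br (.l m) trivial (.i n) trivial u
    rw [sub_eq_iff_eq_add'] at this
    simpa [sb, sgn, par, Finsupp.sum_smul_index, Finsupp.sum_single_index] using this
  lg m n u := by
    have := M.act_br (.l m) trivial (.g n) trivial u
    rw [sub_eq_iff_eq_add'] at this
    simpa [sb, sgn, par, Finsupp.sum_smul_index, Finsupp.sum_single_index] using this
  ii m n u := by
    have := M.act_br (.i m) trivial (.i n) trivial u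
    rw [sub_eq_iff_eq_add'] at this
    simpa [sb, sgn, par] using this
  ig m n u := by
    have := M.act_br (.i m) trivial (.g n) trivial u
    rw [sub_eq_iff_eq_add'] at this
    simpa [sb, sgn, par] using this
  gg m n u := by
    have := M.act_br (.g m) trivial (.g n) trivial u
    rw [sub_eq_iff_eq_add'] at this
    simpa [sb, sgn, par, Finsupp.sum_smul_index, Finsupp.sum_single_index] using this

/-- A graded submodule as a representation. -/
noncomputable def subRep (M : GRep (Set.univ : Set SB)) (U : Submodule ℂ M.V)
    (hU : IsSub M U) : GRep (Set.univ : Set SB) where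
  V := U
  act a := (M.act a).restrict fun u hu => hU.1 a trivial u hu
  grade p := (M.grade p).comap U.subtype
  grade_sup := by
    rintro ⟨v, hv⟩
    obtain ⟨v0, h0, g0, v1, h1, g1, rfl⟩ := hU.2 v hv
    exact ⟨⟨v0, h0⟩, g0, ⟨v1, h1⟩, g1, rfl⟩
  grade_inf := by
    rw [← Submodule.comap_inf, M.grade_inf, Submodule.comap_bot, Submodule.ker_subtype]
  act_grade a ha p v hv := M.act_grade a ha p v hv
  act_br a ha b hb v := by
    refine Subtype.ext ((M.act_br a ha b hb v).trans ?_)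
    simp [Finsupp.sum]

theorem eq_top_of_forall_mem (hind : IsInduced Q ρ M ι) {U : Submodule ℂ M.V}
    (hU : IsSub M U) (hι : ∀ w, ι w ∈ U) : U = ⊤ := by
  obtain ⟨F, ⟨hF, hFι⟩, -⟩ := hind.2 (subRep M U hU) (ι.codRestrict U hι)
    ⟨fun a ha w => Subtype.ext (hind.1.1 a ha w), fun p w hw => hind.1.2 p w hw⟩
  obtain ⟨_, -, huniq⟩ := hind.2 M ι hind.1
  have e1 := huniq LinearMap.id ⟨⟨fun _ _ _ => rfl, fun _ _ h => h⟩, rfl⟩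
  have e2 := huniq (U.subtype ∘ₗ F)
    ⟨⟨fun a ha w => congrArg Subtype.val (hF.1 a ha w), fun p w hw => hF.2 p w hw⟩,
      LinearMap.ext fun w => congrArg Subtype.val (LinearMap.congr_fun hFι w)⟩
  refine eq_top_iff.2 fun w _ => ?_
  have hw : (F w).1 = w := LinearMap.congr_fun (e2.trans e1.symm) w
  exact hw ▸ (F w).2

theorem isSub_generated (M : GRep (Set.univ : Set SB)) {x : M.V} (hx : x ∈ M.grade 0) :
    IsSub M (generated M.act {x}) := by
  refine ⟨fun a _ u hu => generated_stable _ _ a hu, fun u hu => ?_⟩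
  have hle : generated M.act {x} ≤
      (generated M.act {x} ⊓ M.grade 0) ⊔ (generated M.act {x} ⊓ M.grade 1) := by
    refine generated_le (Set.singleton_subset_iff.2 (Submodule.mem_sup_left
      ⟨subset_generated _ _ rfl, hx⟩)) fun a u hu => ?_
    obtain ⟨v0, ⟨h0, g0⟩, v1, ⟨h1, g1⟩, rfl⟩ := Submodule.mem_sup.1 hu
    have s0 := generated_stable M.act {x} a h0
    have s1 := generated_stable M.act {x} a h1
    have t0 := M.act_grade a trivial 0 v0 g0
    have t1 := M.act_grade a trivial 1 v1 g1
    rw [map_add]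
    rcases a with m | m | m
    · exact Submodule.add_mem_sup ⟨s0, t0⟩ ⟨s1, t1⟩
    · exact Submodule.add_mem_sup ⟨s0, t0⟩ ⟨s1, t1⟩
    · rw [add_comm]
      exact Submodule.add_mem_sup ⟨s1, t1⟩ ⟨s0, t0⟩
  obtain ⟨v0, ⟨h0, g0⟩, v1, ⟨h1, g1⟩, rfl⟩ := Submodule.mem_sup.1 (hle hu)
  exact ⟨v0, h0, g0, v1, h1, g1, rfl⟩

theorem modes_act (M : GRep (Set.univ : Set SB)) :
    modes (fun m => M.act (.l m)) (fun m => M.act (.i m)) (fun m => M.act (.g m)) = M.act := by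
  funext a
  cases a <;> rfl

/-- The homogeneous components of an element of a graded submodule lie in the submodule. -/
theorem IsSub.components_mem {U : Submodule ℂ M.V} (hU : IsSub M U) {a b : M.V}
    (ha : a ∈ M.grade 0) (hb : b ∈ M.grade 1) (hab : a + b ∈ U) : a ∈ U ∧ b ∈ U := by
  obtain ⟨v0, h0, g0, v1, h1, g1, e⟩ := hU.2 _ hab
  have e' : a - v0 = v1 - b := by rw [sub_eq_sub_iff_add_eq_add, e, add_comm]
  have hz : a - v0 ∈ M.grade 0 ⊓ M.grade 1 :=
    ⟨Submodule.sub_mem _ ha g0, e' ▸ Submodule.sub_mem _ g1 hb⟩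
  rw [M.grade_inf, Submodule.mem_bot] at hz
  rw [hz] at e'
  exact ⟨sub_eq_zero.1 hz ▸ h0, sub_eq_zero.1 e'.symm ▸ h1⟩

/-- A nonzero module induced from a line spanned by an even highest weight vector with
`c ≠ 0` is simple. -/
theorem isSimple_of_highestWeight {h c : ℂ} (hc : c ≠ 0) (hind : IsInduced Q ρ M ι) {v : ρ.V}
    (hdim : ∀ w : ρ.V, ∃ c : ℂ, w = c • v) (heven : ι v ∈ M.grade 0) (hne : ι v ≠ 0)
    (hx : HighestWeight (fun m => M.act (.l m)) (fun m => M.act (.i m))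
      (fun m => M.act (.g m)) h c (ι v)) : IsSimple M := by
  have htop : ∀ U, IsSub M U → ι v ∈ U → U = ⊤ := fun U hU hv =>
    eq_top_of_forall_mem hind hU fun w => by
      obtain ⟨a, rfl⟩ := hdim w
      rw [map_smul]
      exact Submodule.smul_mem _ _ hv
  refine ⟨⟨_, hne⟩, fun U hU => or_iff_not_imp_left.2 fun hbot => htop U hU ?_⟩
  have hr := relations_act M
  have hgen := htop _ (isSub_generated M heven) (subset_generated _ _ rfl)
  rw [← modes_act] at hgen
  obtain ⟨w, hw, h0, hspan⟩ := exists_mem_top_space hr hx hc hgen hbot fun m u hu =>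
    ⟨hU.1 _ trivial u hu, hU.1 _ trivial u hu, hU.1 _ trivial u hu⟩
  obtain ⟨a, b, rfl⟩ := Submodule.mem_span_pair.1 hspan
  obtain ⟨ha, hb⟩ := IsSub.components_mem hU (Submodule.smul_mem _ a heven)
    (Submodule.smul_mem _ b (M.act_grade (.g 0) trivial 0 _ heven)) hw
  by_cases ha0 : a = 0
  · have hb0 : b ≠ 0 := by
      rintro rfl
      simp [ha0] at h0
    have h1 := hU.1 (.g 0) trivial _ ((Submodule.smul_mem_iff _ hb0).1 hb)
    have h2 : M.act (.g 0) (M.act (.g 0) (ι v)) = c • ι v :=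
      (hr.g_zero_sq _).trans hx.i_zero
    rw [h2] at h1
    exact (Submodule.smul_mem_iff _ hc).1 h1
  · exact (Submodule.smul_mem_iff _ ha0).1 ha

end Modules

section Oscillators

variable {E : Type*} [AddCommGroup E] [Module ℂ E]

/-- Bosonic oscillators `a`, `s` and fermionic oscillators `b`, `t`, indexed by `ℤ`, with
`s`, `t` dual to `a`, `b`, acting in a locally finite way. -/
structure Oscillators (a s b t : ℤ → E →ₗ[ℂ] E) : Prop where
  a_a : ∀ i j u, a i (a j u) = a j (a i u)
  s_s : ∀ i j u, s i (s j u) = s j (s i u)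
  s_a : ∀ i j u, s i (a j u) = a j (s i u) + if i = j then u else 0
  b_b : ∀ i j u, b i (b j u) = -b j (b i u)
  t_t : ∀ i j u, t i (t j u) = -t j (t i u)
  t_b : ∀ i j u, t i (b j u) = -b j (t i u) + if i = j then u else 0
  a_b : ∀ i j u, a i (b j u) = b j (a i u)
  a_t : ∀ i j u, a i (t j u) = t j (a i u)
  s_b : ∀ i j u, s i (b j u) = b j (s i u)
  s_t : ∀ i j u, s i (t j u) = t j (s i u)
  locally_finite : ∀ u, ∃ K : ℤ, ∀ k, K ≤ k →
    a k u = 0 ∧ b k u = 0 ∧ s (-k) u = 0 ∧ t (-k) u = 0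

/-- The sum of a family of operators which is pointwise summable. -/
noncomputable def totalMap [TopologicalSpace E] [DiscreteTopology E] (T : ℤ → E →ₗ[ℂ] E)
    (hT : ∀ u, Summable fun k => T k u) : E →ₗ[ℂ] E where
  toFun u := ∑' k, T k u
  map_add' u v := by simp only [map_add, (hT u).tsum_add (hT v)]
  map_smul' r u := by
    simp only [map_smul, RingHom.id_apply]
    exact ((hT u).hasSum.map (r • LinearMap.id : E →ₗ[ℂ] E)
      continuous_of_discreteTopology).tsum_eq

theorem hasSum_totalMap [TopologicalSpace E] [DiscreteTopology E] {T : ℤ → E →ₗ[ℂ] E}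
    (hT : ∀ u, Summable fun k => T k u) (u : E) : HasSum (fun k => T k u) (totalMap T hT u) :=
  (hT u).hasSum

theorem hasSum_map [TopologicalSpace E] [DiscreteTopology E] (A : E →ₗ[ℂ] E) {f : ℤ → E}
    {u : E} (hf : HasSum f u) : HasSum (fun k => A (f k)) (A u) :=
  hf.map A continuous_of_discreteTopology

omit [Module ℂ E] in
theorem summable_of_support_subset_Icc [TopologicalSpace E] {f : ℤ → E} {p q : ℤ}
    (hf : ∀ k, k < p ∨ q < k → f k = 0) : Summable f := by
  refine summable_of_hasFiniteSupport ((Set.finite_Icc p q).subset fun k hk => ?_)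
  by_contra hmem
  rw [Set.mem_Icc, not_and_or, not_le, not_le] at hmem
  exact hk (hf k hmem)

namespace Oscillators

variable {a s b t : ℤ → E →ₗ[ℂ] E}

/-- The bilinear `a i s j + b i t j`. -/
def quad (a s b t : ℤ → E →ₗ[ℂ] E) (i j : ℤ) : E →ₗ[ℂ] E := a i ∘ₗ s j + b i ∘ₗ t j

theorem quad_apply (i j : ℤ) (u : E) : quad a s b t i j u = a i (s j u) + b i (t j u) := rfl

theorem quad_eq (ho : Oscillators a s b t) (i j : ℤ) (u : E) :
    quad a s b t i j u = s j (a i u) - t j (b i u) := by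
  rw [quad_apply, ho.s_a, ho.t_b]
  abel

theorem quad_a (ho : Oscillators a s b t) (i j n : ℤ) (u : E) :
    quad a s b t i j (a n u) = a n (quad a s b t i j u) + if j = n then a i u else 0 := by
  simp only [quad_apply, ho.s_a, ← ho.a_t, map_add, ho.a_b, ho.a_a i n, apply_ite (a i), map_zero]
  abel

theorem quad_s (ho : Oscillators a s b t) (i j n : ℤ) (u : E) :
    quad a s b t i j (s n u) = s n (quad a s b t i j u) - if i = n then s j u else 0 := by
  simp only [quad_apply, ho.s_a, map_add, ho.s_b, ho.s_t, ho.s_s n j, eq_comm (a := n)]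
  abel

theorem quad_b (ho : Oscillators a s b t) (i j n : ℤ) (u : E) :
    quad a s b t i j (b n u) = b n (quad a s b t i j u) + if j = n then b i u else 0 := by
  simp only [quad_apply, ho.t_b, map_add, ho.s_b, ho.a_b, map_neg, ho.b_b i n,
    apply_ite (b i), map_zero]
  abel

theorem quad_t (ho : Oscillators a s b t) (i j n : ℤ) (u : E) :
    quad a s b t i j (t n u) = t n (quad a s b t i j u) - if i = n then t j u else 0 := by
  simp only [quad_apply, ho.t_b, map_add, ← ho.a_t, ho.s_t, ho.t_t n j, map_neg,
    eq_comm (a := n)]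
  abel

/-- The Heisenberg operators. -/
noncomputable def heis (s : ℤ → E →ₗ[ℂ] E) (c : ℂ) (n : ℤ) : E →ₗ[ℂ] E :=
  (-(n : ℂ)) • s (-n) + (if n = 0 then c else 0) • LinearMap.id

theorem heis_apply (c : ℂ) (n : ℤ) (u : E) :
    heis s c n u = (-(n : ℂ)) • s (-n) u + (if n = 0 then c else 0) • u := rfl

theorem heis_s (ho : Oscillators a s b t) (c : ℂ) (m n : ℤ) (u : E) :
    heis s c m (s n u) = s n (heis s c m u) := by
  simp only [heis_apply, map_add, map_smul, ho.s_s (-m) n]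

theorem heis_heis (ho : Oscillators a s b t) (c : ℂ) (m n : ℤ) (u : E) :
    heis s c m (heis s c n u) = heis s c n (heis s c m u) := by
  simp only [heis_apply c n, map_add, map_smul, ho.heis_s]

theorem heis_b (ho : Oscillators a s b t) (c : ℂ) (m n : ℤ) (u : E) :
    heis s c m (b n u) = b n (heis s c m u) := by
  simp only [heis_apply, map_add, map_smul, ho.s_b]

theorem heis_t (ho : Oscillators a s b t) (c : ℂ) (m n : ℤ) (u : E) :
    heis s c m (t n u) = t n (heis s c m u) := by
  simp only [heis_apply, map_add, map_smul, ho.s_t]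

variable [TopologicalSpace E] [DiscreteTopology E]

omit [DiscreteTopology E] in
theorem summable_quad (ho : Oscillators a s b t) (r : ℤ → ℂ) (m : ℤ) (u : E) :
    Summable fun k => (r k • quad a s b t (k + m) k) u := by
  obtain ⟨K, hK⟩ := ho.locally_finite u
  refine summable_of_support_subset_Icc (p := -K) (q := K - m) fun k hk => ?_
  rcases hk with hk | hk
  · obtain ⟨-, -, h1, h2⟩ := hK (-k) (by omega)
    rw [neg_neg] at h1 h2
    simp [quad_apply, h1, h2]
  · obtain ⟨h1, h2, -, -⟩ := hK (k + m) (by omega)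
    simp [ho.quad_eq, h1, h2]

/-- The Virasoro operators without linear terms. -/
noncomputable def vir (ho : Oscillators a s b t) (m : ℤ) : E →ₗ[ℂ] E :=
  totalMap (fun k => (k : ℂ) • quad a s b t (k + m) k) (ho.summable_quad _ m)

theorem hasSum_vir (ho : Oscillators a s b t) (m : ℤ) (u : E) :
    HasSum (fun k : ℤ => (k : ℂ) • quad a s b t (k + m) k u) (ho.vir m u) :=
  hasSum_totalMap (ho.summable_quad _ m) u

theorem vir_comm (ho : Oscillators a s b t) (m : ℤ) (A : E →ₗ[ℂ] E) {u v : E}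
    (hv : HasSum (fun k : ℤ => (k : ℂ) • (quad a s b t (k + m) k (A u) -
      A (quad a s b t (k + m) k u))) v) : ho.vir m (A u) = A (ho.vir m u) + v := by
  refine (ho.hasSum_vir m (A u)).unique ?_
  convert (hasSum_map A (ho.hasSum_vir m u)).add hv using 2 with k
  rw [map_smul, smul_sub, add_sub_cancel]

theorem vir_a (ho : Oscillators a s b t) (m n : ℤ) (u : E) :
    ho.vir m (a n u) = a n (ho.vir m u) + (n : ℂ) • a (n + m) u := by
  refine ho.vir_comm m (a n) ?_
  convert hasSum_ite_eq n ((n : ℂ) • a (n + m) u) using 2 with k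
  rw [ho.quad_a, add_sub_cancel_left]
  split_ifs with hk
  · rw [hk]
  · exact smul_zero _

theorem vir_b (ho : Oscillators a s b t) (m n : ℤ) (u : E) :
    ho.vir m (b n u) = b n (ho.vir m u) + (n : ℂ) • b (n + m) u := by
  refine ho.vir_comm m (b n) ?_
  convert hasSum_ite_eq n ((n : ℂ) • b (n + m) u) using 2 with k
  rw [ho.quad_b, add_sub_cancel_left]
  split_ifs with hk
  · rw [hk]
  · exact smul_zero _

theorem vir_s (ho : Oscillators a s b t) (m n : ℤ) (u : E) :
    ho.vir m (s n u) = s n (ho.vir m u) + ((m : ℂ) - n) • s (n - m) u := by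
  refine ho.vir_comm m (s n) ?_
  convert hasSum_ite_eq (n - m) (((m : ℂ) - n) • s (n - m) u) using 2 with k
  rw [ho.quad_s, sub_sub_cancel_left]
  by_cases hk : k = n - m
  · subst hk
    simp [← neg_smul]
  · rw [if_neg (by omega), if_neg hk, neg_zero, smul_zero]

theorem vir_t (ho : Oscillators a s b t) (m n : ℤ) (u : E) :
    ho.vir m (t n u) = t n (ho.vir m u) + ((m : ℂ) - n) • t (n - m) u := by
  refine ho.vir_comm m (t n) ?_
  convert hasSum_ite_eq (n - m) (((m : ℂ) - n) • t (n - m) u) using 2 with k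
  rw [ho.quad_t, sub_sub_cancel_left]
  by_cases hk : k = n - m
  · subst hk
    simp [← neg_smul]
  · rw [if_neg (by omega), if_neg hk, neg_zero, smul_zero]

theorem vir_quad (ho : Oscillators a s b t) (m i j : ℤ) (u : E) :
    ho.vir m (quad a s b t i j u) = quad a s b t i j (ho.vir m u) +
      (i : ℂ) • quad a s b t (i + m) j u + ((m : ℂ) - j) • quad a s b t i (j - m) u := by
  simp only [quad_apply, map_add, ho.vir_a, ho.vir_b, ho.vir_s, ho.vir_t, map_smul]
  module

theorem vir_vir (ho : Oscillators a s b t) (m n : ℤ) (u : E) :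
    ho.vir m (ho.vir n u) = ho.vir n (ho.vir m u) + ((n : ℂ) - m) • ho.vir (m + n) u := by
  refine (hasSum_map (ho.vir m) (ho.hasSum_vir n u)).unique ?_
  have h1 : HasSum (fun k : ℤ => ((k : ℂ) * (k + n)) • quad a s b t (k + (m + n)) k u)
    _ := (ho.summable_quad (fun k => (k : ℂ) * (k + n)) (m + n) u).hasSum
  have h2 : HasSum (fun k : ℤ => (((k : ℂ) + m) * k) • quad a s b t (k + (m + n)) k u)
    _ := (ho.summable_quad (fun k => ((k : ℂ) + m) * k) (m + n) u).hasSum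
  have h3 := (Equiv.subRight m).hasSum_iff.2 h2
  have h4 := h1.sub h2
  have h5 : HasSum (fun k : ℤ => ((k : ℂ) * (k + n)) • quad a s b t (k + (m + n)) k u -
      (((k : ℂ) + m) * k) • quad a s b t (k + (m + n)) k u)
      (((n : ℂ) - m) • ho.vir (m + n) u) := by
    convert hasSum_map (((n : ℂ) - m) • LinearMap.id) (ho.hasSum_vir (m + n) u) using 2 with k
    · simp only [LinearMap.smul_apply, LinearMap.id_apply]
      module
    · rfl
  rw [← h4.unique h5]
  convert (ho.hasSum_vir n (ho.vir m u)).add (h1.sub h3) using 2 with k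
  have e : k - m + (m + n) = k + n := by ring
  have e' : k + n + m = k + (m + n) := by ring
  simp only [Function.comp_apply, Equiv.subRight_apply, map_smul, ho.vir_quad, e, e']
  push_cast
  module

omit [DiscreteTopology E] in
theorem summable_heis (ho : Oscillators a s b t) (r : ℤ → ℂ) (c : ℂ) (n : ℤ) (u : E) :
    Summable fun k => (r k • heis s c (n + k) ∘ₗ t k) u := by
  obtain ⟨K, hK⟩ := ho.locally_finite u
  refine summable_of_support_subset_Icc (p := -K) (q := max K 0 - n) fun k hk => ?_
  rcases hk with hk | hk
  · obtain ⟨-, -, -, h1⟩ := hK (-k) (by omega)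
    rw [neg_neg] at h1
    simp [h1]
  · obtain ⟨-, -, h1, -⟩ := hK (n + k) (by omega)
    have h0 : n + k ≠ 0 := by omega
    rw [LinearMap.smul_apply, LinearMap.comp_apply, ho.heis_t, heis_apply, h1, if_neg h0, smul_zero,
      zero_smul, add_zero, map_zero, smul_zero]

/-- The quadratic part of the fermionic current. -/
noncomputable def cur (ho : Oscillators a s b t) (c : ℂ) (n : ℤ) : E →ₗ[ℂ] E :=
  totalMap (fun k => heis s c (n + k) ∘ₗ t k) fun u => by
    simpa using ho.summable_heis (fun _ => 1) c n u

theorem hasSum_cur (ho : Oscillators a s b t) (c : ℂ) (n : ℤ) (u : E) :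
    HasSum (fun k : ℤ => heis s c (n + k) (t k u)) (ho.cur c n u) :=
  hasSum_totalMap (T := fun k => heis s c (n + k) ∘ₗ t k) _ u

theorem cur_heis (ho : Oscillators a s b t) (c : ℂ) (m n : ℤ) (u : E) :
    ho.cur c m (heis s c n u) = heis s c n (ho.cur c m u) := by
  refine (ho.hasSum_cur c m _).unique ?_
  convert hasSum_map (heis s c n) (ho.hasSum_cur c m u) using 2 with k
  rw [ho.heis_heis c n, ← ho.heis_t c n]

theorem cur_t (ho : Oscillators a s b t) (c : ℂ) (m n : ℤ) (u : E) :
    ho.cur c m (t n u) = -t n (ho.cur c m u) := by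
  refine (ho.hasSum_cur c m _).unique ?_
  convert (hasSum_map (t n) (ho.hasSum_cur c m u)).neg using 2 with k
  rw [ho.t_t k n, map_neg, ho.heis_t]

theorem cur_b (ho : Oscillators a s b t) (c : ℂ) (m n : ℤ) (u : E) :
    ho.cur c m (b n u) = -b n (ho.cur c m u) + heis s c (m + n) u := by
  refine (ho.hasSum_cur c m _).unique ?_
  convert (hasSum_map (b n) (ho.hasSum_cur c m u)).neg.add
    (hasSum_ite_eq n (heis s c (m + n) u)) using 2 with k
  rw [ho.t_b, map_add, map_neg, ho.heis_b]
  split_ifs with hk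
  · rw [hk]
  · rw [map_zero]

theorem cur_cur (ho : Oscillators a s b t) (c : ℂ) (m n : ℤ) (u : E) :
    ho.cur c m (ho.cur c n u) = -ho.cur c n (ho.cur c m u) := by
  refine (hasSum_map (ho.cur c m) (ho.hasSum_cur c n u)).unique ?_
  convert (ho.hasSum_cur c n (ho.cur c m u)).neg using 2 with k
  rw [ho.cur_heis, ho.cur_t, map_neg]

/-- The full Virasoro operators. -/
noncomputable def virFull (ho : Oscillators a s b t) (α c : ℂ) (m : ℤ) : E →ₗ[ℂ] E :=
  ho.vir m + c • a m - (α * m) • s (-m) + (if m = 0 then α * c else 0) • LinearMap.id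

theorem virFull_apply (ho : Oscillators a s b t) (α c : ℂ) (m : ℤ) (u : E) :
    ho.virFull α c m u = ho.vir m u + c • a m u - (α * m) • s (-m) u +
      (if m = 0 then α * c else 0) • u := rfl

theorem virFull_s (ho : Oscillators a s b t) (α c : ℂ) (m n : ℤ) (u : E) :
    ho.virFull α c m (s n u) = s n (ho.virFull α c m u) + ((m : ℂ) - n) • s (n - m) u -
      c • if n = m then u else 0 := by
  simp only [virFull_apply, ho.vir_s, map_add, map_sub, map_smul, ho.s_s (-m) n, ho.s_a n m,
    smul_add]
  abel

theorem virFull_a (ho : Oscillators a s b t) (α c : ℂ) (m n : ℤ) (u : E) :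
    ho.virFull α c m (a n u) = a n (ho.virFull α c m u) + (n : ℂ) • a (n + m) u -
      (α * m) • if n = -m then u else 0 := by
  simp only [virFull_apply, ho.vir_a, map_add, map_sub, map_smul, ho.a_a m n, ho.s_a (-m) n,
    smul_add, eq_comm (a := n)]
  abel

theorem virFull_b (ho : Oscillators a s b t) (α c : ℂ) (m n : ℤ) (u : E) :
    ho.virFull α c m (b n u) = b n (ho.virFull α c m u) + (n : ℂ) • b (n + m) u := by
  simp only [virFull_apply, ho.vir_b, map_add, map_sub, map_smul, ho.a_b, ho.s_b]
  abel

theorem virFull_t (ho : Oscillators a s b t) (α c : ℂ) (m n : ℤ) (u : E) :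
    ho.virFull α c m (t n u) = t n (ho.virFull α c m u) + ((m : ℂ) - n) • t (n - m) u := by
  simp only [virFull_apply, ho.vir_t, map_add, map_sub, map_smul, ho.a_t, ho.s_t]
  abel

theorem virFull_heis (ho : Oscillators a s b t) (α c : ℂ) (m n : ℤ) (u : E) :
    ho.virFull α c m (heis s c n u) =
      heis s c n (ho.virFull α c m u) + (n : ℂ) • heis s c (m + n) u := by
  have e : -n - m = -(m + n) := by ring
  have e' : -n = m ↔ m + n = 0 := by omega
  simp only [heis_apply, map_add, map_smul, ho.virFull_s, e, e']
  push_cast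
  split_ifs <;> module

theorem virFull_vir (ho : Oscillators a s b t) (α c : ℂ) (m n : ℤ) (u : E) :
    ho.virFull α c m (ho.vir n u) = ho.vir n (ho.virFull α c m u) +
      ((n : ℂ) - m) • ho.vir (m + n) u - (c * m) • a (m + n) u +
      (α * m * (m + n)) • s (-(m + n)) u := by
  have e : -m - n = -(m + n) := by ring
  simp only [virFull_apply, map_add, map_sub, map_smul, ho.vir_vir m n, ho.vir_a, ho.vir_s, e]
  push_cast
  module

theorem virFull_virFull (ho : Oscillators a s b t) (α c : ℂ) (m n : ℤ) (u : E) :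
    ho.virFull α c m (ho.virFull α c n u) = ho.virFull α c n (ho.virFull α c m u) +
      ((n : ℂ) - m) • ho.virFull α c (m + n) u := by
  have e : -n - m = -(m + n) := by ring
  have e' : -n = m ↔ m + n = 0 := by omega
  have hneg : n = -m ↔ m + n = 0 := by omega
  rw [ho.virFull_apply α c n, ho.virFull_apply α c n, ho.virFull_apply α c (m + n)]
  simp only [map_add, map_sub, map_smul, ho.virFull_vir, ho.virFull_a, ho.virFull_s, e, e', hneg,
    add_comm n m]
  push_cast
  generalize (if n = 0 then α * c else (0 : ℂ)) = r
  split_ifs with h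
  · have : (n : ℂ) = -m := by exact_mod_cast (by omega : n = -m)
    rw [this]
    module
  · module

theorem virFull_cur (ho : Oscillators a s b t) (α c : ℂ) (m n : ℤ) (u : E) :
    ho.virFull α c m (ho.cur c n u) =
      ho.cur c n (ho.virFull α c m u) + (n : ℂ) • ho.cur c (m + n) u := by
  refine (hasSum_map (ho.virFull α c m) (ho.hasSum_cur c n u)).unique ?_
  have h1 : HasSum (fun k : ℤ => ((n : ℂ) + k) • heis s c (m + n + k) (t k u))
    _ := (ho.summable_heis (fun k => (n : ℂ) + k) c (m + n) u).hasSum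
  have h2 : HasSum (fun k : ℤ => (-k : ℂ) • heis s c (m + n + k) (t k u))
    _ := (ho.summable_heis (fun k => -k) c (m + n) u).hasSum
  have h3 := (Equiv.subRight m).hasSum_iff.2 h2
  have h5 : HasSum (fun k : ℤ => ((n : ℂ) + k) • heis s c (m + n + k) (t k u) +
      (-k : ℂ) • heis s c (m + n + k) (t k u)) ((n : ℂ) • ho.cur c (m + n) u) := by
    convert hasSum_map ((n : ℂ) • LinearMap.id) (ho.hasSum_cur c (m + n) u) using 2 with k
    · simp only [LinearMap.smul_apply, LinearMap.id_apply]
      module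
    · rfl
  rw [← (h1.add h2).unique h5]
  convert (ho.hasSum_cur c n (ho.virFull α c m u)).add (h1.add h3) using 2 with k
  have e : m + n + (k - m) = n + k := by ring
  simp only [Function.comp_apply, Equiv.subRight_apply, ho.virFull_heis, ho.virFull_t, map_add,
    map_smul, e, ← add_assoc m n]
  push_cast
  module

/-- The oscillator operators satisfy the relations of the super Heisenberg-Virasoro
algebra. -/
theorem relations (ho : Oscillators a s b t) (α c : ℂ) :
    Relations (ho.virFull α c) (heis s c) (fun n => b n + ho.cur c n) where
  ll := ho.virFull_virFull α c
  li := ho.virFull_heis α c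
  lg m n u := by
    simp only [LinearMap.add_apply, map_add, ho.virFull_b, ho.virFull_cur, add_comm n m]
    module
  ii := ho.heis_heis c
  ig m n u := by
    simp only [LinearMap.add_apply, map_add, ho.heis_b, ho.cur_heis]
  gg m n u := by
    simp only [LinearMap.add_apply, map_add, ho.cur_b, ho.b_b m n, ho.cur_cur c m n,
      add_comm n m]
    module

/-- The vacuum is a highest weight vector. -/
theorem highestWeight (ho : Oscillators a s b t) (α c : ℂ) {x : E}
    (ha : ∀ k, 0 ≤ k → a k x = 0) (hb : ∀ k, 0 ≤ k → b k x = 0)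
    (hs : ∀ k, k < 0 → s k x = 0) (ht : ∀ k, k < 0 → t k x = 0) :
    HighestWeight (ho.virFull α c) (heis s c) (fun n => b n + ho.cur c n) (α * c) c x := by
  have hvir : ∀ m, 0 ≤ m → ho.vir m x = 0 := fun m hm => by
    refine (ho.hasSum_vir m x).unique ?_
    convert hasSum_zero using 2 with k
    rcases lt_or_ge k 0 with hk | hk
    · simp [quad_apply, hs k hk, ht k hk]
    · simp [ho.quad_eq, ha (k + m) (by omega), hb (k + m) (by omega)]
  have hi : ∀ m, 0 < m → heis s c m x = 0 := fun m hm => by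
    simp [heis_apply, hs (-m) (by omega), hm.ne']
  refine ⟨?_, ?_, fun m hm => ?_, hi, fun m hm => ?_⟩
  · simp [virFull_apply, hvir 0 le_rfl, ha 0 le_rfl]
  · simp [heis_apply]
  · simp [virFull_apply, hvir m hm.le, ha m hm.le, hs (-m) (by omega), hm.ne']
  · have hcur : ho.cur c m x = 0 := by
      refine (ho.hasSum_cur c m x).unique ?_
      convert hasSum_zero using 2 with k
      rcases lt_or_ge k 0 with hk | hk
      · rw [ht k hk, map_zero]
      · rw [ho.heis_t, hi _ (by omega), map_zero]
    simp [hb m hm.le, hcur]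

end Oscillators

end Oscillators

section Parity

variable {E : Type*} [AddCommGroup E] [Module ℂ E] [TopologicalSpace E] [DiscreteTopology E]
  {a s b t : ℤ → E →ₗ[ℂ] E} {σ : E →ₗ[ℂ] E}

theorem Oscillators.virFull_parity (ho : Oscillators a s b t)
    (ha : ∀ k u, σ (a k u) = a k (σ u)) (hs : ∀ k u, σ (s k u) = s k (σ u))
    (hb : ∀ k u, σ (b k u) = -b k (σ u)) (ht : ∀ k u, σ (t k u) = -t k (σ u))
    (α c : ℂ) (m : ℤ) (u : E) : σ (ho.virFull α c m u) = ho.virFull α c m (σ u) := by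
  have hvir : σ (ho.vir m u) = ho.vir m (σ u) := by
    refine (hasSum_map σ (ho.hasSum_vir m u)).unique ?_
    convert ho.hasSum_vir m (σ u) using 2 with k
    simp only [quad_apply, map_smul, map_add, ha, hs, hb, ht, map_neg, neg_neg]
  simp only [virFull_apply, map_add, map_sub, map_smul, hvir, ha, hs]

omit [TopologicalSpace E] [DiscreteTopology E] in
theorem Oscillators.heis_parity (hs : ∀ k u, σ (s k u) = s k (σ u)) (c : ℂ) (m : ℤ) (u : E) :
    σ (heis s c m u) = heis s c m (σ u) := by
  simp only [heis_apply, map_add, map_smul, hs]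

theorem Oscillators.cur_parity (ho : Oscillators a s b t)
    (hs : ∀ k u, σ (s k u) = s k (σ u)) (ht : ∀ k u, σ (t k u) = -t k (σ u))
    (c : ℂ) (m : ℤ) (u : E) : σ (ho.cur c m u) = -ho.cur c m (σ u) := by
  refine (hasSum_map σ (ho.hasSum_cur c m u)).unique ?_
  convert (ho.hasSum_cur c m (σ u)).neg using 2 with k
  rw [heis_parity hs, ht, map_neg]

end Parity

section Fock

open scoped TensorProduct

variable {P R : Type*} [AddCommGroup P] [Module ℂ P] [AddCommGroup R] [Module ℂ R]

theorem rTensor_comm_rel {f g : P →ₗ[ℂ] P} {r : ℂ} (h : ∀ p, f (g p) = g (f p) + r • p)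
    (u : P ⊗[ℂ] R) :
    f.rTensor R (g.rTensor R u) = g.rTensor R (f.rTensor R u) + r • u := by
  induction u with
  | zero => simp
  | tmul p q => simp only [LinearMap.rTensor_tmul, h, TensorProduct.add_tmul,
      TensorProduct.smul_tmul']
  | add u v hu hv =>
    simp only [map_add, hu, hv, smul_add]
    abel

theorem lTensor_anticomm_rel {f g : R →ₗ[ℂ] R} {r : ℂ} (h : ∀ p, f (g p) = -g (f p) + r • p)
    (u : P ⊗[ℂ] R) :
    f.lTensor P (g.lTensor P u) = -g.lTensor P (f.lTensor P u) + r • u := by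
  induction u with
  | zero => simp
  | tmul p q => simp only [LinearMap.lTensor_tmul, h, TensorProduct.tmul_add,
      TensorProduct.tmul_smul, TensorProduct.tmul_neg]
  | add u v hu hv =>
    simp only [map_add, hu, hv, smul_add]
    abel

theorem rTensor_lTensor_comm (f : P →ₗ[ℂ] P) (g : R →ₗ[ℂ] R) (u : P ⊗[ℂ] R) :
    f.rTensor R (g.lTensor P u) = g.lTensor P (f.rTensor R u) := by
  rw [← LinearMap.comp_apply, ← LinearMap.comp_apply, LinearMap.rTensor_comp_lTensor,
    LinearMap.lTensor_comp_rTensor]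

/-- Bosonic annihilation operators. -/
noncomputable def bosonD (k : ℤ) : MvPolynomial ℤ ℂ →ₗ[ℂ] MvPolynomial ℤ ℂ :=
  (MvPolynomial.pderiv k).toLinearMap

/-- Bosonic creation operators. -/
noncomputable def bosonX (k : ℤ) : MvPolynomial ℤ ℂ →ₗ[ℂ] MvPolynomial ℤ ℂ :=
  LinearMap.mulLeft ℂ (MvPolynomial.X k)

theorem bosonX_comm (i j : ℤ) (p : MvPolynomial ℤ ℂ) :
    bosonX i (bosonX j p) = bosonX j (bosonX i p) :=
  mul_left_comm _ _ _

theorem bosonD_comm (i j : ℤ) (p : MvPolynomial ℤ ℂ) :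
    bosonD i (bosonD j p) = bosonD j (bosonD i p) := by
  have h : ⁅MvPolynomial.pderiv (R := ℂ) i, MvPolynomial.pderiv j⁆ = 0 :=
    MvPolynomial.derivation_ext fun k => by
      rw [Derivation.commutator_apply, MvPolynomial.pderiv_X, MvPolynomial.pderiv_X,
        Pi.single_apply, Pi.single_apply]
      split_ifs <;> simp
  refine sub_eq_zero.1 ((Derivation.commutator_apply (D1 := MvPolynomial.pderiv i)
    (D2 := MvPolynomial.pderiv j) p).symm.trans ?_)
  rw [h, Derivation.zero_apply]

theorem bosonD_bosonX (i j : ℤ) (p : MvPolynomial ℤ ℂ) :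
    bosonD i (bosonX j p) = bosonX j (bosonD i p) + if i = j then p else 0 := by
  simp only [bosonD, bosonX, LinearMap.mulLeft_apply, Derivation.coeFn_coe,
    MvPolynomial.pderiv_mul, MvPolynomial.pderiv_X, Pi.single_apply,
    eq_comm (a := j), ite_mul, one_mul, zero_mul]
  exact add_comm _ _

theorem eventually_bosonD_eq_zero (p : MvPolynomial ℤ ℂ) :
    ∀ᶠ k in Filter.cofinite, bosonD k p = 0 := by
  filter_upwards [p.vars.finite_toSet.compl_mem_cofinite] with k hk
  exact MvPolynomial.pderiv_eq_zero_of_notMem_vars hk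

/-- Fermionic annihilation operators. -/
noncomputable def fermionD (k : ℤ) :
    ExteriorAlgebra ℂ (ℤ →₀ ℂ) →ₗ[ℂ] ExteriorAlgebra ℂ (ℤ →₀ ℂ) :=
  CliffordAlgebra.contractLeft (Finsupp.lapply k)

/-- Fermionic creation operators. -/
noncomputable def fermionX (k : ℤ) :
    ExteriorAlgebra ℂ (ℤ →₀ ℂ) →ₗ[ℂ] ExteriorAlgebra ℂ (ℤ →₀ ℂ) :=
  LinearMap.mulLeft ℂ (ExteriorAlgebra.ι ℂ (Finsupp.single k 1))

/-- The parity operator of the exterior algebra. -/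
noncomputable def fermionParity :
    ExteriorAlgebra ℂ (ℤ →₀ ℂ) →ₗ[ℂ] ExteriorAlgebra ℂ (ℤ →₀ ℂ) :=
  CliffordAlgebra.involute.toLinearMap

theorem fermionX_comm (i j : ℤ) (w : ExteriorAlgebra ℂ (ℤ →₀ ℂ)) :
    fermionX i (fermionX j w) = -fermionX j (fermionX i w) := by
  simp only [fermionX, LinearMap.mulLeft_apply, ← mul_assoc]
  rw [eq_neg_iff_add_eq_zero, ← add_mul, ExteriorAlgebra.ι_add_mul_swap, zero_mul]

theorem fermionD_comm (i j : ℤ) (w : ExteriorAlgebra ℂ (ℤ →₀ ℂ)) :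
    fermionD i (fermionD j w) = -fermionD j (fermionD i w) :=
  CliffordAlgebra.contractLeft_comm _ _ _

theorem fermionD_fermionX (i j : ℤ) (w : ExteriorAlgebra ℂ (ℤ →₀ ℂ)) :
    fermionD i (fermionX j w) = -fermionX j (fermionD i w) + if i = j then w else 0 := by
  refine (CliffordAlgebra.contractLeft_ι_mul _ _ _).trans ?_
  rw [sub_eq_add_neg, add_comm]
  congr 1
  simp only [Finsupp.lapply_apply, Finsupp.single_apply, eq_comm (a := j), ite_smul, one_smul,
    zero_smul]

theorem eventually_fermionD_eq_zero (w : ExteriorAlgebra ℂ (ℤ →₀ ℂ)) :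
    ∀ᶠ k in Filter.cofinite, fermionD k w = 0 := by
  induction w using CliffordAlgebra.left_induction with
  | algebraMap r => exact .of_forall fun k => CliffordAlgebra.contractLeft_algebraMap _ _ r
  | add x y hx hy =>
    filter_upwards [hx, hy] with k hkx hky
    rw [map_add, hkx, hky, add_zero]
  | ι_mul x m hx =>
    filter_upwards [hx, m.support.finite_toSet.compl_mem_cofinite] with k hk hm
    refine (CliffordAlgebra.contractLeft_ι_mul _ _ _).trans ?_
    have h0 : Finsupp.lapply (R := ℂ) k m = 0 := by simpa using hm
    have h1 : CliffordAlgebra.contractLeft (Finsupp.lapply k) x = 0 := hk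
    rw [h0, h1, zero_smul, mul_zero, sub_zero]

theorem fermionParity_fermionX (k : ℤ) (w : ExteriorAlgebra ℂ (ℤ →₀ ℂ)) :
    fermionParity (fermionX k w) = -fermionX k (fermionParity w) := by
  change CliffordAlgebra.involute (CliffordAlgebra.ι _ _ * w) = -(CliffordAlgebra.ι _ _ * _)
  rw [map_mul, CliffordAlgebra.involute_ι, neg_mul]
  rfl

theorem fermionParity_fermionD (k : ℤ) (w : ExteriorAlgebra ℂ (ℤ →₀ ℂ)) :
    fermionParity (fermionD k w) = -fermionD k (fermionParity w) := by
  induction w using CliffordAlgebra.left_induction with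
  | algebraMap r =>
    simp [fermionParity, fermionD, CliffordAlgebra.contractLeft_algebraMap]
  | add x y hx hy => simp only [map_add, hx, hy, neg_add]
  | ι_mul x m hx =>
    have hx' : CliffordAlgebra.involute (CliffordAlgebra.contractLeft (Finsupp.lapply k) x) =
      -CliffordAlgebra.contractLeft (Finsupp.lapply k) (CliffordAlgebra.involute x) := hx
    simp only [fermionParity, fermionD, AlgHom.toLinearMap_apply,
      CliffordAlgebra.contractLeft_ι_mul, map_sub, map_smul, map_mul,
      CliffordAlgebra.involute_ι, neg_mul, map_neg, hx']
    simp

theorem fermionParity_sq (w : ExteriorAlgebra ℂ (ℤ →₀ ℂ)) :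
    fermionParity (fermionParity w) = w :=
  CliffordAlgebra.involute_involute w

/-- The super Fock space. -/
abbrev Fock : Type := MvPolynomial ℤ ℂ ⊗[ℂ] ExteriorAlgebra ℂ (ℤ →₀ ℂ)

namespace Fock

/-- The bosonic oscillators `a`. -/
noncomputable def a (k : ℤ) : Fock →ₗ[ℂ] Fock :=
  (if 0 ≤ k then bosonD k else bosonX k).rTensor _

/-- The bosonic oscillators dual to `a`. -/
noncomputable def s (k : ℤ) : Fock →ₗ[ℂ] Fock :=
  (if 0 ≤ k then -bosonX k else bosonD k).rTensor _

/-- The fermionic oscillators `b`. -/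
noncomputable def b (k : ℤ) : Fock →ₗ[ℂ] Fock :=
  (if 0 ≤ k then fermionD k else fermionX k).lTensor _

/-- The fermionic oscillators dual to `b`. -/
noncomputable def t (k : ℤ) : Fock →ₗ[ℂ] Fock :=
  (if 0 ≤ k then fermionX k else fermionD k).lTensor _

/-- The parity operator. -/
noncomputable def parity : Fock →ₗ[ℂ] Fock := fermionParity.lTensor _

theorem eventually_eq_zero (u : Fock) :
    ∀ᶠ k in Filter.cofinite, (bosonD k).rTensor _ u = 0 ∧ (fermionD k).lTensor _ u = 0 := by
  induction u using TensorProduct.induction_on with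
  | zero => simp
  | tmul p w =>
    filter_upwards [eventually_bosonD_eq_zero p, eventually_fermionD_eq_zero w] with k hp hw
    simp [hp, hw]
  | add u v hu hv =>
    filter_upwards [hu, hv] with k hku hkv
    simp [hku.1, hku.2, hkv.1, hkv.2]

theorem oscillators : Oscillators a s b t where
  a_a i j u := by
    refine (rTensor_comm_rel (r := 0) (fun p => ?_) u).trans (by simp [a])
    split_ifs with hi hj hj
    · simp [bosonD_comm i j]
    · simp [bosonD_bosonX, show i ≠ j by omega]
    · simp [bosonD_bosonX, show j ≠ i by omega]
    · simp [bosonX_comm i j]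
  s_s i j u := by
    refine (rTensor_comm_rel (r := 0) (fun p => ?_) u).trans (by simp [s])
    split_ifs with hi hj hj
    · simp [bosonX_comm i j]
    · simp [bosonD_bosonX, show j ≠ i by omega]
    · simp [bosonD_bosonX, show i ≠ j by omega]
    · simp [bosonD_comm i j]
  s_a i j u := by
    refine (rTensor_comm_rel (r := if i = j then 1 else 0) (fun p => ?_) u).trans
      (by simp [s, a])
    split_ifs with hi hj hij hij hj hij hij
    all_goals try omega
    · simp [bosonD_bosonX, hij]
    · simp [bosonD_bosonX, Ne.symm hij]
    · simp [bosonX_comm i j]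
    · simp [bosonD_comm i j]
    · simp [bosonD_bosonX, hij]
    · simp [bosonD_bosonX, hij]
  b_b i j u := by
    refine (lTensor_anticomm_rel (r := 0) (fun p => ?_) u).trans (by simp [b])
    split_ifs with hi hj hj
    · simp [fermionD_comm i j]
    · simp [fermionD_fermionX, show i ≠ j by omega]
    · simp [fermionD_fermionX, show j ≠ i by omega]
    · simp [fermionX_comm i j]
  t_t i j u := by
    refine (lTensor_anticomm_rel (r := 0) (fun p => ?_) u).trans (by simp [t])
    split_ifs with hi hj hj
    · simp [fermionX_comm i j]
    · simp [fermionD_fermionX, show j ≠ i by omega]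
    · simp [fermionD_fermionX, show i ≠ j by omega]
    · simp [fermionD_comm i j]
  t_b i j u := by
    refine (lTensor_anticomm_rel (r := if i = j then 1 else 0) (fun p => ?_) u).trans
      (by simp [t, b])
    split_ifs with hi hj hij hij hj hij hij
    all_goals try omega
    · simp [fermionD_fermionX, hij]
    · simp [fermionD_fermionX, Ne.symm hij]
    · simp [fermionX_comm i j]
    · simp [fermionD_comm i j]
    · simp [fermionD_fermionX, hij]
    · simp [fermionD_fermionX, hij]
  a_b i j u := rTensor_lTensor_comm _ _ _
  a_t i j u := rTensor_lTensor_comm _ _ _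
  s_b i j u := rTensor_lTensor_comm _ _ _
  s_t i j u := rTensor_lTensor_comm _ _ _
  locally_finite u := by
    have h := eventually_eq_zero u
    rw [Int.cofinite_eq, Filter.eventually_sup, Filter.eventually_atTop,
      Filter.eventually_atBot] at h
    obtain ⟨⟨q, hq⟩, p, hp⟩ := h
    refine ⟨max p (max (-q) 1), fun k hk => ?_⟩
    rw [a, s, b, t, if_pos (by omega), if_pos (by omega), if_neg (by omega), if_neg (by omega)]
    exact ⟨(hp k (by omega)).1, (hp k (by omega)).2, (hq (-k) (by omega)).1,
      (hq (-k) (by omega)).2⟩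

theorem a_parity (k : ℤ) (u : Fock) : parity (a k u) = a k (parity u) :=
  (rTensor_lTensor_comm _ _ _).symm

theorem s_parity (k : ℤ) (u : Fock) : parity (s k u) = s k (parity u) :=
  (rTensor_lTensor_comm _ _ _).symm

theorem b_parity (k : ℤ) (u : Fock) : parity (b k u) = -b k (parity u) := by
  refine (lTensor_anticomm_rel (r := 0) (fun p => ?_) u).trans (by simp [parity, b])
  split_ifs
  · simp [fermionParity_fermionD]
  · simp [fermionParity_fermionX]

theorem t_parity (k : ℤ) (u : Fock) : parity (t k u) = -t k (parity u) := by
  refine (lTensor_anticomm_rel (r := 0) (fun p => ?_) u).trans (by simp [parity, t])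
  split_ifs
  · simp [fermionParity_fermionX]
  · simp [fermionParity_fermionD]

theorem parity_parity (u : Fock) : parity (parity u) = u := by
  rw [parity, ← LinearMap.comp_apply, ← LinearMap.lTensor_comp,
    show fermionParity ∘ₗ fermionParity = LinearMap.id from LinearMap.ext fermionParity_sq,
    LinearMap.lTensor_id, LinearMap.id_apply]

/-- The vacuum. -/
noncomputable def vac : Fock := 1 ⊗ₜ 1

theorem vac_ne_zero : vac ≠ 0 := one_ne_zero (α := Fock)

theorem parity_vac : parity vac = vac := by
  simp [parity, vac, fermionParity]

theorem bosonD_vac (k : ℤ) : (bosonD k).rTensor _ vac = 0 := by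
  simp [vac, bosonD]

theorem fermionD_vac (k : ℤ) : (fermionD k).lTensor _ vac = 0 := by
  simp [vac, fermionD]

theorem highestWeight_vac [TopologicalSpace Fock] [DiscreteTopology Fock] (α c : ℂ) :
    HighestWeight (oscillators.virFull α c) (Oscillators.heis s c)
      (fun n => b n + oscillators.cur c n) (α * c) c vac :=
  oscillators.highestWeight α c
    (fun k hk => by rw [a, if_pos hk, bosonD_vac])
    (fun k hk => by rw [b, if_pos hk, fermionD_vac])
    (fun k hk => by rw [s, if_neg hk.not_ge, bosonD_vac])
    (fun k hk => by rw [t, if_neg hk.not_ge, fermionD_vac])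

end Fock

end Fock

theorem eq_zero_or_one (p : ZMod 2) : p = 0 ∨ p = 1 := by
  revert p
  decide

section SuperModule

variable {W : Type} [AddCommGroup W] [Module ℂ W] {L I G : ℤ → W →ₗ[ℂ] W} {σ : W →ₗ[ℂ] W}

/-- The action of the basis elements given by three families of operators. -/
def ofModes (L I G : ℤ → W →ₗ[ℂ] W) : SB → W →ₗ[ℂ] W
  | .l m => L m
  | .i m => I m
  | .g m => G m

theorem Relations.ofModes_br (hR : Relations L I G) (x y : SB) (u : W) :
    ofModes L I G x (ofModes L I G y u) - sgn x y • ofModes L I G y (ofModes L I G x u) =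
      (sb x y).sum fun z r => r • ofModes L I G z u := by
  have hsum : ∀ z (r : ℂ), ((r • Finsupp.single z (1 : ℂ)).sum fun z r =>
      r • ofModes L I G z u) = r • ofModes L I G z u := by
    simp [Finsupp.sum_single_index]
  cases x with
  | l m =>
    cases y with
    | l n =>
      simp only [sb, hsum]
      simp [ofModes, sgn, par, hR.ll m n]
    | i n => simp [ofModes, sb, sgn, par, hR.li m n]
    | g n => simp [ofModes, sb, sgn, par, hR.lg m n]
  | i m =>
    cases y with
    | l n =>
      simp only [sb, hsum]
      simp [ofModes, sgn, par, hR.li n m, add_comm n m]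
    | i n => simp [ofModes, sb, sgn, par, hR.ii m n]
    | g n => simp [ofModes, sb, sgn, par, hR.ig m n]
  | g m =>
    cases y with
    | l n =>
      simp only [sb, hsum]
      simp [ofModes, sgn, par, hR.lg n m, add_comm n m]
    | i n => simp [ofModes, sb, sgn, par, hR.ig n m]
    | g n => simp [ofModes, sb, sgn, par, hR.gg m n]

/-- The eigenspace of the parity operator `σ` on which it acts by `(-1)^p`. -/
def parityGrade (σ : W →ₗ[ℂ] W) (p : ZMod 2) : Submodule ℂ W :=
  LinearMap.ker (σ - (if p = 0 then 1 else -1 : ℂ) • LinearMap.id)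

theorem mem_parityGrade {p : ZMod 2} {u : W} :
    u ∈ parityGrade σ p ↔ σ u = (if p = 0 then 1 else -1 : ℂ) • u := by
  rw [parityGrade, LinearMap.mem_ker, LinearMap.sub_apply, sub_eq_zero, LinearMap.smul_apply,
    LinearMap.id_apply]

theorem ofModes_mem_parityGrade (hL : ∀ m u, σ (L m u) = L m (σ u))
    (hI : ∀ m u, σ (I m u) = I m (σ u)) (hG : ∀ m u, σ (G m u) = -G m (σ u)) (x : SB)
    {p : ZMod 2} {u : W} (hu : u ∈ parityGrade σ p) :
    ofModes L I G x u ∈ parityGrade σ (par x + p) := by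
  rw [mem_parityGrade] at hu ⊢
  cases x with
  | l m => simp only [ofModes, par, zero_add, hL, hu, map_smul]
  | i m => simp only [ofModes, par, zero_add, hI, hu, map_smul]
  | g m =>
    simp only [ofModes, par, hG, hu, map_smul, ← neg_smul]
    congr 1
    rcases eq_zero_or_one p with rfl | rfl
    · simp
    · simp [show (1 : ZMod 2) + 1 = 0 from rfl]

/-- The representation of the super Heisenberg-Virasoro algebra given by operators satisfying
its relations and a parity operator. -/
def Relations.toGRep (hR : Relations L I G) (hσ : ∀ u, σ (σ u) = u)
    (hL : ∀ m u, σ (L m u) = L m (σ u)) (hI : ∀ m u, σ (I m u) = I m (σ u))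
    (hG : ∀ m u, σ (G m u) = -G m (σ u)) : GRep (Set.univ : Set SB) where
  V := W
  act := ofModes L I G
  grade := parityGrade σ
  grade_sup u := by
    refine ⟨(2⁻¹ : ℂ) • (u + σ u), ?_, (2⁻¹ : ℂ) • (u - σ u), ?_, by module⟩
    · simp [mem_parityGrade, hσ, add_comm]
    · simp [mem_parityGrade, hσ]
  grade_inf := by
    refine (Submodule.eq_bot_iff _).2 fun u hu => ?_
    obtain ⟨h0, h1⟩ := Submodule.mem_inf.1 hu
    rw [mem_parityGrade] at h0 h1
    rw [h0] at h1
    rw [if_pos rfl, if_neg one_ne_zero, one_smul, neg_one_smul, eq_neg_iff_add_eq_zero,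
      ← two_smul ℂ] at h1
    exact (smul_eq_zero.1 h1).resolve_left two_ne_zero
  act_grade x _ _ _ hu := ofModes_mem_parityGrade hL hI hG x hu
  act_br x _ y _ u := hR.ofModes_br x y u

end SuperModule

/-- There is a representation with a nonzero even highest weight vector of weight `(h, c)`. -/
theorem exists_highestWeight_rep (h : ℂ) {c : ℂ} (hc : c ≠ 0) :
    ∃ (N : GRep (Set.univ : Set SB)) (x : N.V), x ≠ 0 ∧ x ∈ N.grade 0 ∧
      HighestWeight (fun m => N.act (.l m)) (fun m => N.act (.i m)) (fun m => N.act (.g m))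
        h c x := by
  let _ : TopologicalSpace Fock := ⊥
  have : DiscreteTopology Fock := ⟨rfl⟩
  have hw := Fock.highestWeight_vac (h / c) c
  rw [div_mul_cancel₀ h hc] at hw
  refine ⟨(Fock.oscillators.relations (h / c) c).toGRep Fock.parity_parity
    (Fock.oscillators.virFull_parity Fock.a_parity Fock.s_parity Fock.b_parity Fock.t_parity _ _)
    (Oscillators.heis_parity Fock.s_parity _) (fun m u => ?_), Fock.vac, Fock.vac_ne_zero, ?_, hw⟩
  · simp only [LinearMap.add_apply, map_add, Fock.b_parity, neg_add,
      Fock.oscillators.cur_parity Fock.s_parity Fock.t_parity]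
  · exact mem_parityGrade.2 (Fock.parity_vac.trans (one_smul ℂ _).symm)

section OneDimensional

variable {ρ : GRep QVerma} {v : ρ.V} {h c : ℂ}

/-- A one-dimensional even representation maps to any even highest weight vector of the same
weight. -/
theorem exists_equivMap (heven : ρ.grade 0 = ⊤) (hv : v ≠ 0) (hdim : ∀ w : ρ.V, ∃ r : ℂ, w = r • v)
    (hρ : HighestWeight (fun m => ρ.act (.l m)) (fun m => ρ.act (.i m)) (fun m => ρ.act (.g m))
      h c v) {N : GRep (Set.univ : Set SB)} {x : N.V} (hx0 : x ∈ N.grade 0)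
    (hx : HighestWeight (fun m => N.act (.l m)) (fun m => N.act (.i m)) (fun m => N.act (.g m))
      h c x) : ∃ f : ρ.V →ₗ[ℂ] N.V, SEquivMap QVerma ρ N f ∧ f v = x := by
  have hbij : Function.Bijective (LinearMap.toSpanSingleton ℂ ρ.V v) :=
    ⟨smul_left_injective ℂ hv, fun w => (hdim w).imp fun r hr => hr.symm⟩
  let f : ρ.V →ₗ[ℂ] N.V := LinearMap.toSpanSingleton ℂ N.V x ∘ₗ
    (LinearEquiv.ofBijective _ hbij).symm.toLinearMap
  have hfv : f v = x := by
    have : (LinearEquiv.ofBijective _ hbij).symm v = 1 :=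
      (LinearEquiv.symm_apply_eq _).2 (by simp)
    simp [f, this]
  refine ⟨f, ⟨fun a ha w => ?_, fun p w hw => ?_⟩, hfv⟩
  · obtain ⟨r, rfl⟩ := hdim w
    simp only [map_smul, hfv]
    congr 1
    cases a with
    | l m =>
      rcases (show 0 ≤ m from ha).eq_or_lt with rfl | hm
      · rw [hρ.l_zero, hx.l_zero, map_smul, hfv]
      · rw [hρ.l_pos m hm, hx.l_pos m hm, map_zero]
    | i m =>
      rcases (show 0 ≤ m from ha).eq_or_lt with rfl | hm
      · rw [hρ.i_zero, hx.i_zero, map_smul, hfv]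
      · rw [hρ.i_pos m hm, hx.i_pos m hm, map_zero]
    | g m =>
      have hm : 0 < m := show 1 ≤ m from ha
      rw [hρ.g_pos m hm, hx.g_pos m hm, map_zero]
  · rcases eq_zero_or_one p with rfl | rfl
    · obtain ⟨r, rfl⟩ := hdim w
      rw [map_smul, hfv]
      exact Submodule.smul_mem _ r hx0
    · have hw0 : w ∈ ρ.grade 0 ⊓ ρ.grade 1 := ⟨heven ▸ Submodule.mem_top, hw⟩
      rw [ρ.grade_inf, Submodule.mem_bot] at hw0
      rw [hw0, map_zero]
      exact Submodule.zero_mem _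

theorem highestWeight_map {N : GRep (Set.univ : Set SB)} {f : ρ.V →ₗ[ℂ] N.V}
    (hf : SEquivMap QVerma ρ N f)
    (hρ : HighestWeight (fun m => ρ.act (.l m)) (fun m => ρ.act (.i m)) (fun m => ρ.act (.g m))
      h c v) :
    HighestWeight (fun m => N.act (.l m)) (fun m => N.act (.i m)) (fun m => N.act (.g m))
      h c (f v) where
  l_zero := by rw [← hf.1 (.l 0) (le_refl (0 : ℤ)), hρ.l_zero, map_smul]
  i_zero := by rw [← hf.1 (.i 0) (le_refl (0 : ℤ)), hρ.i_zero, map_smul]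
  l_pos m hm := by rw [← hf.1 (.l m) (show 0 ≤ m from hm.le), hρ.l_pos m hm, map_zero]
  i_pos m hm := by rw [← hf.1 (.i m) (show 0 ≤ m from hm.le), hρ.i_pos m hm, map_zero]
  g_pos m hm := by rw [← hf.1 (.g m) (show 1 ≤ m from hm), hρ.g_pos m hm, map_zero]

end OneDimensional

end SuperHV

/-- For `h, c₀ ∈ ℂ` with `c₀ ≠ 0`, the Verma module
`𝔙(h, c₀) = U(𝔖) ⊗_{U(𝔅)} ℂv_h`, induced from the one-dimensional purely even
`𝔅`-module `ℂv_h` with `L₀ v_h = h v_h`, `I₀ v_h = c₀ v_h` and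
`L_m v_h = I_m v_h = G_m v_h = 0` for `m ≥ 1`, is a simple 𝔖-module. -/
theorem verma_module_simple (h c₀ : ℂ) (hc₀ : c₀ ≠ 0)
    (ρ : GRep QVerma) (heven : ρ.grade 0 = ⊤)
    (v : ρ.V) (hv : v ≠ 0) (hdim : ∀ w : ρ.V, ∃ c : ℂ, w = c • v)
    (hL0 : ρ.act (.l 0) v = h • v) (hI0 : ρ.act (.i 0) v = c₀ • v)
    (hpos : ∀ m : ℤ, 1 ≤ m →
      ρ.act (.l m) v = 0 ∧ ρ.act (.i m) v = 0 ∧ ρ.act (.g m) v = 0)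
    (M : GRep (Set.univ : Set SB)) (ι : ρ.V →ₗ[ℂ] M.V)
    (hind : IsInduced QVerma ρ M ι) :
    IsSimple M := by
  have hρ : SuperHV.HighestWeight (fun m => ρ.act (.l m)) (fun m => ρ.act (.i m))
      (fun m => ρ.act (.g m)) h c₀ v :=
    ⟨hL0, hI0, fun m hm => (hpos m hm).1, fun m hm => (hpos m hm).2.1,
      fun m hm => (hpos m hm).2.2⟩
  obtain ⟨N, x, hx, hx0, hxw⟩ := SuperHV.exists_highestWeight_rep h hc₀
  obtain ⟨f, hf, hfv⟩ := SuperHV.exists_equivMap heven hv hdim hρ hx0 hxw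
  obtain ⟨F, ⟨-, hF⟩, -⟩ := hind.2 N f hf
  refine SuperHV.isSimple_of_highestWeight hc₀ hind hdim
    (hind.1.2 0 v (heven ▸ Submodule.mem_top)) (fun h0 => hx ?_)
    (SuperHV.highestWeight_map hind.1 hρ)
  rw [← hfv, ← hF, LinearMap.comp_apply, h0, map_zero]
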